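/- Let p > 1, μ ∈ ℝ, and let k ∈ C(Ω) be nonnegative and not identically zero. Let u₁ > 0 and u₂ ≥ 0 in Ω satisfy, in the viscosity sense, F(x,D²u₁)+μu₁ ≤ k(x)u₁^p and F(x,D²u₂)+μu₂ ≥ k(x)u₂^p in Ω. If u₁ ≥ u₂ on ∂Ω, then u₁ ≥ u₂ in Ω. -/

import Mathlib

open scoped Matrix Topology
open Bornology MeasureTheory

noncomputable section

/-- Euclidean space `ℝ^N`. -/
abbrev Euc (N : ℕ) := EuclideanSpace ℝ (Fin N)

/-- The Hessian matrix of a (test) function `φ` at `x`, with entries the second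
partial derivatives in the coordinate directions. -/
def hessianMatrix {N : ℕ} (φ : Euc N → ℝ) (x : Euc N) : Matrix (Fin N) (Fin N) ℝ :=
  Matrix.of fun i j =>
    iteratedFDeriv ℝ 2 φ x ![EuclideanSpace.single i (1 : ℝ), EuclideanSpace.single j (1 : ℝ)]

/-- Loewner (partial) order on real square matrices: `A ≤ B` iff `B - A` is positive
semidefinite. -/
def MatLE {n : Type*} [Fintype n] (A B : Matrix n n ℝ) : Prop := (B - A).PosSemidef

/-- `u` is a viscosity subsolution of `G(x, u, D²u) ≥ 0` on `Ω`: at any interior point where a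
`C²` function `φ` touches `u` from above, `G(x₀, u(x₀), D²φ(x₀)) ≥ 0`. -/
def ViscSubsol {N : ℕ} (Ω : Set (Euc N))
    (G : Euc N → ℝ → Matrix (Fin N) (Fin N) ℝ → ℝ) (u : Euc N → ℝ) : Prop :=
  ∀ x₀ ∈ Ω, ∀ φ : Euc N → ℝ, ContDiff ℝ 2 φ → u x₀ = φ x₀ →
    IsLocalMaxOn (fun x => u x - φ x) Ω x₀ →
    0 ≤ G x₀ (u x₀) (hessianMatrix φ x₀)

/-- `u` is a viscosity supersolution of `G(x, u, D²u) ≤ 0` on `Ω`: at any interior point where a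
`C²` function `φ` touches `u` from below, `G(x₀, u(x₀), D²φ(x₀)) ≤ 0`. -/
def ViscSupersol {N : ℕ} (Ω : Set (Euc N))
    (G : Euc N → ℝ → Matrix (Fin N) (Fin N) ℝ → ℝ) (u : Euc N → ℝ) : Prop :=
  ∀ x₀ ∈ Ω, ∀ φ : Euc N → ℝ, ContDiff ℝ 2 φ → u x₀ = φ x₀ →
    IsLocalMinOn (fun x => u x - φ x) Ω x₀ →
    G x₀ (u x₀) (hessianMatrix φ x₀) ≤ 0

/-- (F1): uniform ellipticity with ellipticity constants `0 < lam ≤ Lam`. -/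
def IsF1 {N : ℕ} (Ω : Set (Euc N)) (F : Euc N → Matrix (Fin N) (Fin N) ℝ → ℝ)
    (lam Lam : ℝ) : Prop :=
  0 < lam ∧ lam ≤ Lam ∧
    ∀ x ∈ Ω, ∀ X P : Matrix (Fin N) (Fin N) ℝ, X.IsSymm → P.PosSemidef →
      lam * P.trace ≤ F x (X + P) - F x X ∧ F x (X + P) - F x X ≤ Lam * P.trace

/-- (F2): positive 1-homogeneity in the matrix variable. -/
def IsF2 {N : ℕ} (Ω : Set (Euc N)) (F : Euc N → Matrix (Fin N) (Fin N) ℝ → ℝ) : Prop :=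
  ∀ x ∈ Ω, ∀ t : ℝ, 0 ≤ t → ∀ X : Matrix (Fin N) (Fin N) ℝ, F x (t • X) = t * F x X

/-- (F3): the standard structure condition of viscosity solution theory, with a modulus of
continuity `ω`. -/
def IsF3 {N : ℕ} (Ω : Set (Euc N)) (F : Euc N → Matrix (Fin N) (Fin N) ℝ → ℝ) : Prop :=
  ∃ ω : ℝ → ℝ, Monotone ω ∧ ω 0 = 0 ∧ ContinuousAt ω 0 ∧ (∀ t, 0 ≤ ω t) ∧
    ∀ α : ℝ, 0 < α → ∀ x ∈ Ω, ∀ y ∈ Ω, ∀ X Y : Matrix (Fin N) (Fin N) ℝ,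
      X.IsSymm → Y.IsSymm →
      MatLE ((-(3 * α)) • (1 : Matrix (Fin N ⊕ Fin N) (Fin N ⊕ Fin N) ℝ))
        (Matrix.fromBlocks X 0 0 (-Y)) →
      MatLE (Matrix.fromBlocks X 0 0 (-Y))
        ((3 * α) • Matrix.fromBlocks 1 (-1) (-1) 1) →
      F x X - F y Y ≤ ω (α * ‖x - y‖ ^ 2 + ‖x - y‖)

/-- Continuity of `F` on `Ω × 𝒮_N`. -/
def FCont {N : ℕ} (Ω : Set (Euc N)) (F : Euc N → Matrix (Fin N) (Fin N) ℝ → ℝ) : Prop :=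
  ContinuousOn (fun q : Euc N × Matrix (Fin N) (Fin N) ℝ => F q.1 q.2) (Ω ×ˢ Set.univ)

/-- A bounded domain (open, bounded, nonempty, connected set) of class `C²`, described by a
`C²` defining function with nonvanishing gradient on the boundary. -/
def IsC2Domain {N : ℕ} (Ω : Set (Euc N)) : Prop :=
  IsOpen Ω ∧ IsBounded Ω ∧ Ω.Nonempty ∧ IsConnected Ω ∧
    ∃ f : Euc N → ℝ, ContDiff ℝ 2 f ∧ Ω = {x | f x < 0} ∧
      frontier Ω = {x | f x = 0} ∧ ∀ x ∈ frontier Ω, fderiv ℝ f x ≠ 0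

/-- The operator `F(x, M) + μ r` of the eigenvalue problem. -/
def eigenG {N : ℕ} (F : Euc N → Matrix (Fin N) (Fin N) ℝ → ℝ) (μ : ℝ) :
    Euc N → ℝ → Matrix (Fin N) (Fin N) ℝ → ℝ :=
  fun x r M => F x M + μ * r

/-- The principal eigenvalue (à la Berestycki–Nirenberg–Varadhan) of `F` on `D`:
`λ₁⁺(D) = sup {μ : ∃ ψ > 0 in D, F(x, D²ψ) + μψ ≤ 0 in D in the viscosity sense}`. -/
def principalEigenvalue {N : ℕ} (F : Euc N → Matrix (Fin N) (Fin N) ℝ → ℝ)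
    (D : Set (Euc N)) : ℝ :=
  sSup {μ : ℝ | ∃ ψ : Euc N → ℝ, (∀ x ∈ D, 0 < ψ x) ∧ ViscSupersol D (eigenG F μ) ψ}

/-- The logistic operator `F(x, M) + μ r - k(x) r^p`. -/
def logisticG {N : ℕ} (F : Euc N → Matrix (Fin N) (Fin N) ℝ → ℝ) (μ : ℝ)
    (k : Euc N → ℝ) (p : ℝ) : Euc N → ℝ → Matrix (Fin N) (Fin N) ℝ → ℝ :=
  fun x r M => F x M + μ * r - k x * Real.rpow r p

/-- `u` is a (positive, viscosity) solution of problem (1):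
`F(x,D²u) + μ u = k(x) u^p` in `Ω`, `u > 0` in `Ω`, `u = 0` on `∂Ω`. -/
def IsSolP1 {N : ℕ} (Ω : Set (Euc N)) (F : Euc N → Matrix (Fin N) (Fin N) ℝ → ℝ)
    (μ : ℝ) (k : Euc N → ℝ) (p : ℝ) (u : Euc N → ℝ) : Prop :=
  ContinuousOn u (closure Ω) ∧ (∀ x ∈ Ω, 0 < u x) ∧
    ViscSubsol Ω (logisticG F μ k p) u ∧ ViscSupersol Ω (logisticG F μ k p) u ∧
    ∀ x ∈ frontier Ω, u x = 0

/-- Condition (K1): `k` is bounded below by a positive constant on `Ω`. -/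
def CondK1 {N : ℕ} (Ω : Set (Euc N)) (k : Euc N → ℝ) : Prop :=
  ∃ k₀ : ℝ, 0 < k₀ ∧ ∀ x ∈ Ω, k₀ ≤ k x

/-- Condition (K2), with the vanishing subdomain `Ω₀` explicit: `Ω₀` is a `C²` bounded domain
compactly contained in `Ω`, `k = 0` on `closure Ω₀`, and `inf_{Ω \ Ω₁} k > 0` for every open
`Ω₁ ⊊ Ω` compactly containing `Ω₀`. -/
def CondK2 {N : ℕ} (Ω Ω₀ : Set (Euc N)) (k : Euc N → ℝ) : Prop :=
  IsC2Domain Ω₀ ∧ closure Ω₀ ⊆ Ω ∧ (∀ x ∈ closure Ω₀, k x = 0) ∧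
    ∀ Ω₁ : Set (Euc N), IsOpen Ω₁ → Ω₁ ⊆ Ω → Ω₁ ≠ Ω → closure Ω₀ ⊆ Ω₁ →
      ∃ c : ℝ, 0 < c ∧ ∀ x ∈ Ω \ Ω₁, c ≤ k x

/-- The sup norm `‖u‖_{L^∞(S)}`. -/
def supNorm {N : ℕ} (S : Set (Euc N)) (u : Euc N → ℝ) : ℝ := sSup (u '' S)

/-- The Pucci maximal operator `𝓜⁺_{lam,Lam}(M) = sup {tr(A M) : lam I ≤ A ≤ Lam I}`. -/
def pucciSup {N : ℕ} (lam Lam : ℝ) (M : Matrix (Fin N) (Fin N) ℝ) : ℝ :=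
  sSup {t : ℝ | ∃ A : Matrix (Fin N) (Fin N) ℝ, A.IsSymm ∧
    MatLE (lam • (1 : Matrix (Fin N) (Fin N) ℝ)) A ∧
    MatLE A (Lam • (1 : Matrix (Fin N) (Fin N) ℝ)) ∧ t = (A * M).trace}

/-- Solution of the blow-up problem on the annulus `Ω \ closure Ω₀`:
`F(x,D²u) + μ u = k(x) u^p` and `u > 0` in `Ω \ closure Ω₀`, `u = 0` on `∂Ω`,
`u(x) → +∞` as `x → ∂Ω₀`. -/
def IsSolBlowUp {N : ℕ} (Ω Ω₀ : Set (Euc N)) (F : Euc N → Matrix (Fin N) (Fin N) ℝ → ℝ)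
    (μ : ℝ) (k : Euc N → ℝ) (p : ℝ) (u : Euc N → ℝ) : Prop :=
  ContinuousOn u (closure Ω \ closure Ω₀) ∧ (∀ x ∈ Ω \ closure Ω₀, 0 < u x) ∧
    ViscSubsol (Ω \ closure Ω₀) (logisticG F μ k p) u ∧
    ViscSupersol (Ω \ closure Ω₀) (logisticG F μ k p) u ∧
    (∀ x ∈ frontier Ω, u x = 0) ∧
    ∀ M : ℝ, ∃ δ : ℝ, 0 < δ ∧
      ∀ x ∈ Ω \ closure Ω₀, Metric.infDist x (frontier Ω₀) < δ → M ≤ u x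

/-- Solution of the Dirichlet problem on the annulus `Ω \ closure Ω₀` with boundary data `0`
on `∂Ω` and `φb` on `∂Ω₀`. -/
def IsSolAnnulus {N : ℕ} (Ω Ω₀ : Set (Euc N)) (F : Euc N → Matrix (Fin N) (Fin N) ℝ → ℝ)
    (μ : ℝ) (k : Euc N → ℝ) (p : ℝ) (φb : Euc N → ℝ) (u : Euc N → ℝ) : Prop :=
  ContinuousOn u (closure (Ω \ closure Ω₀)) ∧ (∀ x ∈ Ω \ closure Ω₀, 0 < u x) ∧
    ViscSubsol (Ω \ closure Ω₀) (logisticG F μ k p) u ∧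
    ViscSupersol (Ω \ closure Ω₀) (logisticG F μ k p) u ∧
    (∀ x ∈ frontier Ω, u x = 0) ∧ ∀ x ∈ frontier Ω₀, u x = φb x

open scoped InnerProductSpace
open Filter Set Metric

section SemiconvexFunctions

variable {H : Type*} [NormedAddCommGroup H] [InnerProductSpace ℝ H]

lemma abs_sub_le_of_local_increment {g : ℝ → ℝ} {L C : ℝ}
    (hg : ∀ s ∈ Icc (0 : ℝ) 1, ∀ t ∈ Icc (0 : ℝ) 1,
      g s - L * |t - s| - C * (t - s) ^ 2 ≤ g t) :
    |g 1 - g 0| ≤ L := by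
  have habs : ∀ s ∈ Icc (0 : ℝ) 1, ∀ t ∈ Icc (0 : ℝ) 1,
      |g t - g s| ≤ L * |t - s| + C * (t - s) ^ 2 := by
    intro s hs t ht
    have h1 := hg s hs t ht
    have h2 := hg t ht s hs
    rw [abs_sub_comm s t] at h2
    rw [abs_le]
    constructor <;> nlinarith
  have hm : ∀ m : ℕ, 0 < m → |g 1 - g 0| ≤ L + C / m := by
    intro m hm
    have hm' : (0 : ℝ) < m := by exact_mod_cast hm
    have htel : g 1 - g 0 = ∑ j ∈ Finset.range m, (g ((j + 1 : ℕ) / m) - g ((j : ℕ) / m)) := by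
      rw [Finset.sum_range_sub (fun j : ℕ => g ((j : ℝ) / m))]
      simp [div_self hm'.ne']
    rw [htel]
    refine (Finset.abs_sum_le_sum_abs _ _).trans ?_
    have hterm : ∀ j ∈ Finset.range m,
        |g ((j + 1 : ℕ) / m) - g ((j : ℕ) / m)| ≤ L * (1 / m) + C * (1 / m) ^ 2 := by
      intro j hj
      have hj' : (j : ℝ) + 1 ≤ m := by exact_mod_cast Finset.mem_range.1 hj
      have hj0 : (0 : ℝ) ≤ j := by positivity
      have := habs ((j : ℝ) / m) ⟨by positivity, by rw [div_le_one hm']; linarith⟩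
        (((j + 1 : ℕ) : ℝ) / m) ⟨by positivity, by rw [div_le_one hm']; push_cast; linarith⟩
      have hd : ((j + 1 : ℕ) : ℝ) / m - (j : ℝ) / m = 1 / m := by push_cast; ring
      rw [hd, abs_of_pos (by positivity : (0 : ℝ) < 1 / m)] at this
      exact this
    refine (Finset.sum_le_sum hterm).trans (le_of_eq ?_)
    simp only [Finset.sum_const, Finset.card_range, nsmul_eq_mul]
    field_simp
  refine le_of_forall_pos_le_add fun ε hε => ?_
  obtain ⟨m, hm1⟩ := exists_nat_gt (C / ε)
  have hm0 : (0 : ℝ) < m + 1 := by positivity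
  have := hm (m + 1) (by omega)
  refine this.trans ?_
  push_cast
  have : C / (m + 1) ≤ ε := by
    rw [div_le_iff₀ hm0]
    rw [div_lt_iff₀ hε] at hm1
    nlinarith
  linarith

/-- `a` selects a subgradient of `w` up to a quadratic error with constant `M`. -/
def IsSubgradientSelection (w : H → ℝ) (a : H → H) (M : ℝ) : Prop :=
  ∀ x x', w x + ⟪a x, x' - x⟫_ℝ - M * ‖x' - x‖ ^ 2 ≤ w x'

lemma IsSubgradientSelection.eq_of_upper_contact {w : H → ℝ} {a : H → H} {M : ℝ}
    (ha : IsSubgradientSelection w a M) {x p : H}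
    (hp : ∀ᶠ x' in 𝓝 x, w x' ≤ w x + ⟪p, x' - x⟫_ℝ) : a x = p := by
  by_contra hne
  set v := a x - p with hv
  have hv0 : 0 < ‖v‖ := norm_pos_iff.2 (sub_ne_zero.2 hne)
  have hcont : Tendsto (fun t : ℝ => x + t • v) (𝓝 0) (𝓝 x) := by
    have : Continuous fun t : ℝ => x + t • v := by fun_prop
    simpa using this.tendsto 0
  have hev := (hcont.eventually hp).filter_mono (nhdsWithin_le_nhds (s := Ioi (0 : ℝ)))
  have hsmall : ∀ᶠ t : ℝ in 𝓝[>] 0, M * t < 1 := by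
    have : Tendsto (fun t : ℝ => M * t) (𝓝 0) (𝓝 0) := by
      have : Continuous fun t : ℝ => M * t := by fun_prop
      simpa using this.tendsto 0
    exact (this.eventually (gt_mem_nhds one_pos)).filter_mono nhdsWithin_le_nhds
  obtain ⟨t, ⟨h1, h2⟩, ht⟩ := ((hev.and hsmall).and self_mem_nhdsWithin).exists
  have ht : 0 < t := ht
  have h3 := ha x (x + t • v)
  simp only [add_sub_cancel_left, inner_smul_right, norm_smul, Real.norm_eq_abs,
    abs_of_pos ht] at h1 h3
  have h4 : ⟪a x, v⟫_ℝ = ⟪p, v⟫_ℝ + ‖v‖ ^ 2 := by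
    rw [← real_inner_self_eq_norm_sq, ← inner_add_left, hv]; simp
  rw [h4] at h3
  have hv2 : 0 < t * ‖v‖ ^ 2 := by positivity
  nlinarith

lemma IsSubgradientSelection.norm_sub_le {w : H → ℝ} {a : H → H} {M : ℝ}
    (ha : IsSubgradientSelection w a M) {x₀ y z : H} {r : ℝ}
    (hy : y ∈ ball x₀ r) (hz : z ∈ ball x₀ r)
    (hc : ∀ x' ∈ closedBall x₀ (3 * r), w x' ≤ w y + ⟪a y, x' - y⟫_ℝ) :
    ‖a z - a y‖ ≤ 2 * M * ‖z - y‖ := by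
  set v := a z - a y with hv
  rcases eq_or_ne v 0 with h0 | h0
  · rcases eq_or_ne z y with h | h
    · simp [hv, h]
    · have h1 := hc z (ball_subset_closedBall (ball_subset_ball (by
        linarith [pos_of_mem_ball hz]) hz))
      have h2 := ha y z
      have hzy : 0 < ‖z - y‖ ^ 2 := by
        have : 0 < ‖z - y‖ := norm_pos_iff.2 (sub_ne_zero.2 h)
        positivity
      have : 0 ≤ M := by
        by_contra hM
        push Not at hM
        nlinarith
      rw [h0, norm_zero]
      positivity
  have hv0 : 0 < ‖v‖ := norm_pos_iff.2 h0
  rcases eq_or_ne z y with h | h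
  · simp [hv, h]
  set d := ‖z - y‖ with hd
  have hd0 : 0 < d := norm_pos_iff.2 (sub_ne_zero.2 h)
  have hdr : d < 2 * r := by
    rw [hd, ← dist_eq_norm]
    have := dist_triangle_right z y x₀
    rw [mem_ball] at hy hz
    linarith
  set x' := z + (d / ‖v‖) • v with hx'
  have hxz : ‖x' - z‖ = d := by
    rw [hx', add_sub_cancel_left, norm_smul, Real.norm_eq_abs, abs_of_pos (by positivity)]
    field_simp
  have hmem : x' ∈ closedBall x₀ (3 * r) := by
    rw [mem_closedBall]
    have := dist_triangle x' z x₀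
    rw [dist_eq_norm x' z, hxz] at this
    rw [mem_ball] at hz
    linarith
  have e1 := hc x' hmem
  have e2 := ha z x'
  have e3 := ha y z
  have e4 : ⟪v, x' - z⟫_ℝ = d * ‖v‖ := by
    rw [hx', add_sub_cancel_left, inner_smul_right, real_inner_self_eq_norm_sq]
    field_simp
  have e5 : ⟪a y, x' - y⟫_ℝ = ⟪a y, x' - z⟫_ℝ + ⟪a y, z - y⟫_ℝ := by
    rw [← inner_add_right]; simp
  rw [hv, inner_sub_left] at e4
  rw [hxz] at e2
  rw [e5] at e1
  have : d * ‖v‖ ≤ d * (2 * M * d) := by nlinarith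
  exact le_of_mul_le_mul_left this hd0

lemma IsSubgradientSelection.eventually_second_order {w : H → ℝ} {a : H → H} {M : ℝ}
    (ha : IsSubgradientSelection w a M) {x : H} {A : H →L[ℝ] H} (hA : HasFDerivAt a A x)
    {κ : ℝ} (hκ : 0 < κ) :
    ∀ᶠ h in 𝓝 (0 : H), |w (x + h) - w x - ⟪a x, h⟫_ℝ - ⟪A h, h⟫_ℝ / 2| ≤ κ * ‖h‖ ^ 2 := by
  have h1 := hA.isLittleO.def hκ
  rw [Metric.eventually_nhds_iff_ball] at h1
  obtain ⟨δ, hδ, h1⟩ := h1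
  filter_upwards [ball_mem_nhds (0 : H) hδ] with h hh
  rw [mem_ball_zero_iff] at hh
  set g : ℝ → ℝ := fun t => w (x + t • h) - t * ⟪a x, h⟫_ℝ - t ^ 2 * ⟪A h, h⟫_ℝ / 2 with hg
  have := abs_sub_le_of_local_increment (g := g) (L := κ * ‖h‖ ^ 2)
    (C := |M * ‖h‖ ^ 2 + ⟪A h, h⟫_ℝ / 2|) ?_
  · convert this using 2
    simp [hg]
    ring
  intro s hs t _
  have h2 := h1 (x + s • h) (by
    rw [mem_ball, dist_eq_norm, add_sub_cancel_left, norm_smul, Real.norm_eq_abs,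
      abs_of_nonneg hs.1]
    nlinarith [hs.2, norm_nonneg h])
  rw [add_sub_cancel_left, norm_smul, Real.norm_eq_abs, abs_of_nonneg hs.1, map_smul] at h2
  have h3 := ha (x + s • h) (x + t • h)
  have h4 : x + t • h - (x + s • h) = (t - s) • h := by rw [sub_smul]; abel
  rw [h4, inner_smul_right, norm_smul, mul_pow, Real.norm_eq_abs, sq_abs] at h3
  have h5 : |⟪a (x + s • h) - a x - s • A h, h⟫_ℝ| ≤ κ * ‖h‖ ^ 2 := by
    refine (abs_real_inner_le_norm _ _).trans ?_
    calc _ ≤ κ * (s * ‖h‖) * ‖h‖ := by gcongr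
      _ = s * (κ * ‖h‖ ^ 2) := by ring
      _ ≤ 1 * (κ * ‖h‖ ^ 2) := by
        have := hs.2
        gcongr
      _ = _ := one_mul _
  have h6 : -(κ * ‖h‖ ^ 2 * |t - s|) ≤ (t - s) * ⟪a (x + s • h) - a x - s • A h, h⟫_ℝ := by
    refine (abs_le.1 ?_).1
    rw [abs_mul, mul_comm]
    gcongr
  rw [inner_sub_left, inner_sub_left, inner_smul_left, RCLike.conj_to_real] at h6
  have h7 : (M * ‖h‖ ^ 2 + ⟪A h, h⟫_ℝ / 2) * (t - s) ^ 2 ≤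
      |M * ‖h‖ ^ 2 + ⟪A h, h⟫_ℝ / 2| * (t - s) ^ 2 := by
    gcongr; exact le_abs_self _
  simp only [hg]
  nlinarith

/-- `w` has the second-order expansion `w x + ⟪b, h⟫ + ⟪A h, h⟫ / 2 + o(‖h‖ ^ 2)` at `x`. -/
def HasSecondOrderExpansion (w : H → ℝ) (b : H) (A : H →L[ℝ] H) (x : H) : Prop :=
  ∀ κ > 0, ∀ᶠ h in 𝓝 (0 : H), |w (x + h) - w x - ⟪b, h⟫_ℝ - ⟪A h, h⟫_ℝ / 2| ≤ κ * ‖h‖ ^ 2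

lemma nonneg_of_homogeneous {q : H → ℝ} (hq : ∀ (t : ℝ) h, q (t • h) = t ^ 2 * q h)
    (hev : ∀ κ > 0, ∀ᶠ h in 𝓝 (0 : H), -(κ * ‖h‖ ^ 2) ≤ q h) (h : H) : 0 ≤ q h := by
  refine le_of_forall_pos_le_add fun ε hε => ?_
  have hκ : 0 < ε / (‖h‖ ^ 2 + 1) := by positivity
  have hcont : Tendsto (fun t : ℝ => t • h) (𝓝 0) (𝓝 0) := by
    have : Continuous fun t : ℝ => t • h := by fun_prop
    simpa using this.tendsto 0
  obtain ⟨t, h1, ht⟩ := (((hcont.eventually (hev _ hκ)).filter_mono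
    (nhdsWithin_le_nhds (s := Ioi (0 : ℝ)))).and self_mem_nhdsWithin).exists
  have ht : 0 < t := ht
  rw [hq, norm_smul, mul_pow, Real.norm_eq_abs, sq_abs] at h1
  have h2 : 0 ≤ t ^ 2 * (q h + ε / (‖h‖ ^ 2 + 1) * ‖h‖ ^ 2) := by linarith
  have h3 := nonneg_of_mul_nonneg_right h2 (by positivity)
  have h4 : ε / (‖h‖ ^ 2 + 1) * ‖h‖ ^ 2 ≤ ε := by
    rw [div_mul_eq_mul_div, div_le_iff₀ (by positivity)]
    nlinarith
  linarith

end SemiconvexFunctions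

section JensenLemma

variable {H : Type*} [NormedAddCommGroup H] [InnerProductSpace ℝ H] [FiniteDimensional ℝ H]

lemma eventually_exists_mem_of_density_one [MeasurableSpace H] [BorelSpace H] {ν : Measure H}
    [ν.IsAddHaarMeasure] {S : Set H} {x : H}
    (hx : Tendsto (fun r => ν (S ∩ closedBall x r) / ν (closedBall x r)) (𝓝[>] 0) (𝓝 1))
    {η : ℝ} (hη : 0 < η) (hη1 : η ≤ 1) :
    ∀ᶠ z in 𝓝[≠] x, ∃ y ∈ S, ‖y - z‖ ≤ η * ‖z - x‖ := by
  set n := Module.finrank ℝ H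
  set β : ENNReal := 1 - ENNReal.ofReal ((η / 2) ^ n) with hβ
  have hβ1 : β < 1 := ENNReal.sub_lt_self ENNReal.one_ne_top one_ne_zero
    (by rw [Ne, ENNReal.ofReal_eq_zero, not_le]; positivity)
  have hev : ∀ᶠ r in 𝓝[>] (0 : ℝ), β < ν (S ∩ closedBall x r) / ν (closedBall x r) :=
    hx.eventually (lt_mem_nhds hβ1)
  have hr : Tendsto (fun z => 2 * ‖z - x‖) (𝓝[≠] x) (𝓝[>] 0) := by
    refine tendsto_nhdsWithin_iff.2 ⟨?_, ?_⟩
    · have : Continuous fun z : H => 2 * ‖z - x‖ := by fun_prop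
      simpa using (this.tendsto x).mono_left nhdsWithin_le_nhds
    · filter_upwards [self_mem_nhdsWithin] with z hz
      have : 0 < ‖z - x‖ := norm_pos_iff.2 (sub_ne_zero.2 hz)
      simpa using this
  filter_upwards [hr.eventually hev, self_mem_nhdsWithin] with z hz hzx
  by_contra! hcon
  set ρ := ‖z - x‖ with hρ
  have hρ0 : 0 < ρ := norm_pos_iff.2 (sub_ne_zero.2 hzx)
  have hsub : S ∩ closedBall x (2 * ρ) ⊆ closedBall x (2 * ρ) \ closedBall z (η * ρ) := by
    rintro y ⟨hy, hy2⟩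
    refine ⟨hy2, fun hyz => ?_⟩
    have := hcon y hy
    rw [mem_closedBall, dist_eq_norm] at hyz
    linarith
  have hsub2 : closedBall z (η * ρ) ⊆ closedBall x (2 * ρ) := by
    refine closedBall_subset_closedBall' ?_
    rw [dist_eq_norm, ← hρ]
    nlinarith
  have hb0 : ν (ball (0 : H) 1) ≠ 0 := (measure_ball_pos ν 0 one_pos).ne'
  have hbt : ν (ball (0 : H) 1) ≠ ⊤ := measure_ball_lt_top.ne
  have hm1 : ν (closedBall x (2 * ρ)) = ENNReal.ofReal ((2 * ρ) ^ n) * ν (ball (0 : H) 1) :=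
    Measure.addHaar_closedBall ν x (by positivity)
  have hm2 : ν (closedBall z (η * ρ)) =
      ENNReal.ofReal ((η / 2) ^ n) * ν (closedBall x (2 * ρ)) := by
    rw [hm1, Measure.addHaar_closedBall ν z (by positivity), ← mul_assoc,
      ← ENNReal.ofReal_mul (by positivity), ← mul_pow]
    have : η * ρ = η / 2 * (2 * ρ) := by ring
    rw [this]
  have hc0 : ν (closedBall x (2 * ρ)) ≠ 0 :=
    (measure_closedBall_pos ν x (by positivity)).ne'
  have hct : ν (closedBall x (2 * ρ)) ≠ ⊤ := measure_closedBall_lt_top.ne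
  have hle : ν (S ∩ closedBall x (2 * ρ)) ≤ β * ν (closedBall x (2 * ρ)) := by
    refine (measure_mono hsub).trans ?_
    rw [measure_sdiff hsub2 measurableSet_closedBall.nullMeasurableSet
      measure_closedBall_lt_top.ne, hm2, hβ, ENNReal.sub_mul (fun _ _ => hct), one_mul]
  have := ENNReal.div_le_of_le_mul hle
  exact absurd hz (not_lt.2 this)

omit [FiniteDimensional ℝ H] in
lemma IsSubgradientSelection.hasFDerivAt_of_density {w : H → ℝ} {a : H → H} {M : ℝ}
    (ha : IsSubgradientSelection w a M) {x₀ x : H} {r : ℝ} {S : Set H}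
    (hSr : S ⊆ ball x₀ r) (hxr : x ∈ S) (hM : 0 ≤ M)
    (hS : ∀ y ∈ S, ∀ x' ∈ closedBall x₀ (3 * r), w x' ≤ w y + ⟪a y, x' - y⟫_ℝ)
    (hdens : ∀ η : ℝ, 0 < η → η ≤ 1 → ∀ᶠ z in 𝓝[≠] x, ∃ y ∈ S, ‖y - z‖ ≤ η * ‖z - x‖)
    {A : H →L[ℝ] H} (hA : HasFDerivWithinAt a A S x) : HasFDerivAt a A x := by
  rw [hasFDerivAt_iff_isLittleO, Asymptotics.isLittleO_iff]
  intro κ hκ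
  have h1 := (hasFDerivWithinAt_iff_isLittleO.1 hA).def (c := κ / 4) (by positivity)
  rw [eventually_nhdsWithin_iff, Metric.eventually_nhds_iff_ball] at h1
  obtain ⟨δ, hδ, h1⟩ := h1
  set η := min 1 (κ / (2 * (2 * M + ‖A‖ + 1))) with hη
  have hη0 : 0 < η := lt_min one_pos (by positivity)
  have hη1 : η ≤ 1 := min_le_left _ _
  have hη2 : (2 * M + ‖A‖) * η ≤ κ / 2 := by
    have h2 : η ≤ κ / (2 * (2 * M + ‖A‖ + 1)) := min_le_right _ _
    rw [le_div_iff₀ (by positivity)] at h2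
    nlinarith [norm_nonneg A]
  have h2 := hdens η hη0 hη1
  rw [eventually_nhdsWithin_iff] at h2
  filter_upwards [h2, ball_mem_nhds x (half_pos hδ), isOpen_ball.mem_nhds (hSr hxr)]
    with z hz hzδ hzr
  rcases eq_or_ne z x with rfl | hne
  · simp
  obtain ⟨y, hyS, hy⟩ := hz hne
  set ρ := ‖z - x‖ with hρ
  have hρ0 : 0 ≤ ρ := norm_nonneg _
  have hyx : ‖y - x‖ ≤ 2 * ρ := by
    calc ‖y - x‖ = ‖(y - z) + (z - x)‖ := by congr 1; abel
      _ ≤ ‖y - z‖ + ‖z - x‖ := norm_add_le _ _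
      _ ≤ 2 * ρ := by nlinarith
  have h3 : ‖a y - a x - A (y - x)‖ ≤ κ / 4 * ‖y - x‖ := by
    refine h1 y ?_ hyS
    rw [mem_ball, dist_eq_norm] at hzδ ⊢
    linarith
  have h4 := ha.norm_sub_le (hSr hyS) hzr (hS y hyS)
  rw [norm_sub_rev z y] at h4
  have h5 : ‖A (y - z)‖ ≤ ‖A‖ * ‖y - z‖ := A.le_opNorm _
  have h6 : a z - a x - A (z - x) = (a z - a y) + (a y - a x - A (y - x)) + A (y - z) := by
    have : A (z - x) = A (y - x) - A (y - z) := by rw [← map_sub]; congr 1; abel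
    rw [this]; abel
  rw [h6]
  calc _ ≤ ‖a z - a y‖ + ‖a y - a x - A (y - x)‖ + ‖A (y - z)‖ := norm_add₃_le
    _ ≤ 2 * M * (η * ρ) + κ / 4 * (2 * ρ) + ‖A‖ * (η * ρ) := by
      refine add_le_add_three (h4.trans ?_) (h3.trans ?_) (h5.trans ?_) <;> gcongr
    _ = ((2 * M + ‖A‖) * η) * ρ + κ / 2 * ρ := by ring
    _ ≤ κ / 2 * ρ + κ / 2 * ρ := by gcongr
    _ = κ * ρ := by ring

/-- Jensen's lemma combined with a punctual second-order expansion: a semiconvex function with a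
strict interior maximum has, near its maximum value, a point of twice differentiability with
nonpositive Hessian. -/
theorem IsSubgradientSelection.exists_second_order_expansion {w : H → ℝ} {a : H → H} {M : ℝ}
    (ha : IsSubgradientSelection w a M) (hw : Continuous w) (hM : 0 ≤ M) {x₀ : H} {r θ : ℝ}
    (hr : 0 < r) (hθ : 0 < θ) (hout : ∀ x, r ≤ ‖x - x₀‖ → w x ≤ w x₀ - θ) :
    ∃ x, w x₀ - θ ≤ w x ∧ ∃ A : H →L[ℝ] H,
      HasSecondOrderExpansion w (a x) A x ∧ ∀ h, ⟪A h, h⟫_ℝ ≤ 0 := by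
  let _ : MeasurableSpace H := borel H
  have : BorelSpace H := ⟨rfl⟩
  set ν : Measure H := Measure.hausdorffMeasure (Module.finrank ℝ H) with hν
  set S : Set H := {x | x ∈ ball x₀ r ∧ w x₀ - θ ≤ w x ∧
    ∀ x' ∈ closedBall x₀ (3 * r), w x' ≤ w x + ⟪a x, x' - x⟫_ℝ} with hS
  have hSr : S ⊆ ball x₀ r := fun x hx => hx.1
  have hmem : ∀ x ∈ ball x₀ r, closedBall x₀ (3 * r) ∈ 𝓝 x := fun x hx =>
    mem_of_superset (isOpen_ball.mem_nhds hx)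
      ((ball_subset_ball (by linarith)).trans ball_subset_closedBall)
  have hlip : LipschitzOnWith (2 * M).toNNReal a S := by
    refine LipschitzOnWith.of_dist_le_mul fun y hy z hz => ?_
    rw [dist_eq_norm, dist_eq_norm, Real.coe_toNNReal _ (by positivity)]
    exact ha.norm_sub_le hz.1 hy.1 hz.2.2
  have himg : ball (0 : H) (θ / (4 * r)) ⊆ a '' S := by
    intro p hp
    rw [mem_ball_zero_iff, lt_div_iff₀ (by positivity)] at hp
    have hcont : Continuous fun x => w x - ⟪p, x - x₀⟫_ℝ := by fun_prop
    obtain ⟨x, hx, hmax⟩ := (isCompact_closedBall x₀ (3 * r)).exists_isMaxOn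
      ⟨x₀, mem_closedBall_self (by positivity)⟩ hcont.continuousOn
    have hmax' : ∀ y ∈ closedBall x₀ (3 * r), w y - ⟪p, y - x₀⟫_ℝ ≤ w x - ⟪p, x - x₀⟫_ℝ := hmax
    have h0 := hmax' x₀ (mem_closedBall_self (by positivity))
    simp only [sub_self, inner_zero_right, sub_zero] at h0
    have hpx : |⟪p, x - x₀⟫_ℝ| ≤ ‖p‖ * ‖x - x₀‖ := abs_real_inner_le_norm _ _
    rw [mem_closedBall, dist_eq_norm] at hx
    have hpx2 := (abs_le.1 hpx).1
    have hpx3 : ‖p‖ * ‖x - x₀‖ ≤ ‖p‖ * (3 * r) := by gcongr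
    have hxr : ‖x - x₀‖ < r := by
      by_contra hcon
      have := hout x (not_lt.1 hcon)
      nlinarith [norm_nonneg p]
    have hcontact : ∀ x' ∈ closedBall x₀ (3 * r), w x' ≤ w x + ⟪p, x' - x⟫_ℝ := by
      intro x' hx'
      have := hmax' x' hx'
      have h2 : ⟪p, x' - x⟫_ℝ = ⟪p, x' - x₀⟫_ℝ - ⟪p, x - x₀⟫_ℝ := by
        rw [← inner_sub_right]; congr 1; abel
      rw [h2]; linarith
    have hxb : x ∈ ball x₀ r := by rwa [mem_ball, dist_eq_norm]
    have hap : a x = p := ha.eq_of_upper_contact (by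
      filter_upwards [hmem x hxb] with x' hx' using hcontact x' hx')
    refine ⟨x, ⟨hxb, ?_, by rwa [hap]⟩, hap⟩
    nlinarith [norm_nonneg p, norm_nonneg (x - x₀)]
  have hSpos : ν S ≠ 0 := by
    intro h0
    have h1 := hlip.hausdorffMeasure_image_le (d := Module.finrank ℝ H) (by positivity)
    rw [← hν, h0, mul_zero] at h1
    have h2 : 0 < ν (ball (0 : H) (θ / (4 * r))) := measure_ball_pos ν _ (by positivity)
    exact absurd (h2.trans_le (measure_mono himg)) (not_lt.2 h1)
  have hae := (hlip.ae_differentiableWithinAt_of_mem (μ := ν)).and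
    (ae_imp_of_ae_restrict (Besicovitch.ae_tendsto_measure_inter_div ν S))
  obtain ⟨x, hxS, hdiff, hdens⟩ : ∃ x, x ∈ S ∧ DifferentiableWithinAt ℝ a S x ∧
      Tendsto (fun r => ν (S ∩ closedBall x r) / ν (closedBall x r)) (𝓝[>] 0) (𝓝 1) := by
    by_contra! hcon
    refine hSpos (measure_mono_null (fun x hx => ?_) hae)
    intro hx2
    exact hcon x hx (hx2.1 hx) (hx2.2 hx)
  obtain ⟨A, hA⟩ := hdiff
  have hA' := ha.hasFDerivAt_of_density hSr hxS hM (fun y hy => hy.2.2)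
    (fun η h0 h1 => eventually_exists_mem_of_density_one hdens h0 h1) hA
  have hexp : HasSecondOrderExpansion w (a x) A x :=
    fun κ hκ => ha.eventually_second_order hA' hκ
  refine ⟨x, hxS.2.1, A, hexp, fun h => ?_⟩
  have hq := nonneg_of_homogeneous (q := fun h => -⟪A h, h⟫_ℝ)
    (fun t h => by simp [inner_smul_left, inner_smul_right]; ring) (fun κ hκ => ?_) h
  · linarith
  · have hshift : Tendsto (fun h : H => x + h) (𝓝 0) (𝓝 x) := by
      have : Continuous fun h : H => x + h := by fun_prop
      simpa using this.tendsto 0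
    filter_upwards [hexp (κ / 2) (by positivity), hshift.eventually (hmem x hxS.1)] with h h1 h2
    have h3 := hxS.2.2 _ h2
    rw [add_sub_cancel_left] at h3
    have := (abs_le.1 h1).1
    linarith

end JensenLemma

section TheoremOnSums

variable {E : Type*} [NormedAddCommGroup E]

/-- The sup-convolution of `U` over the set `K`. -/
def supConv (K : Set E) (U : E → ℝ) (c : ℝ) (x : E) : ℝ :=
  sSup ((fun y => U y - c * ‖x - y‖ ^ 2) '' K)

lemma continuousOn_sub_mul_norm_sq {K : Set E} {U : E → ℝ} (hU : ContinuousOn U K) (c : ℝ)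
    (x : E) : ContinuousOn (fun y => U y - c * ‖x - y‖ ^ 2) K :=
  hU.sub (by fun_prop)

lemma exists_supConv_eq {K : Set E} (hK : IsCompact K) (hne : K.Nonempty) {U : E → ℝ}
    (hU : ContinuousOn U K) (c : ℝ) (x : E) :
    ∃ y ∈ K, supConv K U c x = U y - c * ‖x - y‖ ^ 2 :=
  hK.exists_sSup_image_eq hne (continuousOn_sub_mul_norm_sq hU c x)

lemma le_supConv {K : Set E} (hK : IsCompact K) {U : E → ℝ}
    (hU : ContinuousOn U K) (c : ℝ) (x : E) {y : E} (hy : y ∈ K) :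
    U y - c * ‖x - y‖ ^ 2 ≤ supConv K U c x :=
  le_csSup (hK.image_of_continuousOn (continuousOn_sub_mul_norm_sq hU c x)).bddAbove
    (mem_image_of_mem _ hy)

lemma continuous_supConv {K : Set E} (hK : IsCompact K) {U : E → ℝ}
    (hU : ContinuousOn U K) (c : ℝ) : Continuous (supConv K U c) := by
  have : CompactSpace K := isCompact_iff_compactSpace.1 hK
  have h := IsCompact.continuous_sSup (isCompact_univ (X := K))
    (f := fun (x : E) (y : K) => U y - c * ‖x - y‖ ^ 2) (by
      have hU' : Continuous fun p : E × K => U p.2 := (hU.domRestrict).comp continuous_snd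
      exact hU'.sub (by fun_prop))
  convert h using 2 with x
  unfold supConv
  congr 1
  ext s
  simp

lemma exists_penalization {K : Set E} (hK : IsCompact K) {U V : E → ℝ}
    (hV : ContinuousOn V K) {x₀ : E} {η : ℝ} (hη : 0 < η)
    (hmax : ∀ x ∈ K, U x - V x ≤ U x₀ - V x₀ - η * ‖x - x₀‖ ^ 2) {ε : ℝ} (hε : 0 < ε) :
    ∃ α > 0, ∃ θ > 0, ∀ x y, ∀ x' ∈ K, ∀ y' ∈ K,
      U x₀ - V x₀ - θ ≤ U x' - V y' - 3 * α / 2 * (‖x - x'‖ ^ 2 + ‖y - y'‖ ^ 2)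
        - α / 2 * ‖x - y‖ ^ 2 →
      ‖x' - x₀‖ < ε ∧ ‖y' - x₀‖ < ε ∧ ‖x - x₀‖ < ε ∧ ‖y - x₀‖ < ε ∧
        α * ‖x' - y'‖ ^ 2 + ‖x' - y'‖ < ε := by
  obtain ⟨Mv, hMv⟩ := (hK.image_of_continuousOn hV).isBounded.exists_norm_le
  have hMv' : ∀ x ∈ K, |V x| ≤ Mv := fun x hx => hMv _ (mem_image_of_mem V hx)
  set σ := min (η * (ε / 4) ^ 2 / 2) (min ((ε / 4) ^ 2 / 12) (ε / 48)) with hσ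
  have hσ0 : 0 < σ := lt_min (by positivity) (lt_min (by positivity) (by positivity))
  have hσ1 : σ ≤ η * (ε / 4) ^ 2 / 2 := min_le_left _ _
  have hσ2 : σ ≤ (ε / 4) ^ 2 / 12 := (min_le_right _ _).trans (min_le_left _ _)
  have hσ3 : σ ≤ ε / 48 := (min_le_right _ _).trans (min_le_right _ _)
  have huc := Metric.uniformContinuousOn_iff.1 (hK.uniformContinuousOn_of_continuous hV) σ hσ0
  obtain ⟨δ, hδ, huc⟩ := huc
  set α := 1 + 6 * (1 + 2 * |Mv|) / δ ^ 2 with hα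
  have hα1 : 1 ≤ α := by
    have : 0 ≤ 6 * (1 + 2 * |Mv|) / δ ^ 2 := by positivity
    linarith
  have hα0 : 0 < α := by linarith
  refine ⟨α, hα0, min 1 σ, lt_min one_pos hσ0, fun x y x' hx' y' hy' h => ?_⟩
  set A := ‖x - x'‖
  set B := ‖y - y'‖
  set C := ‖x - y‖
  set R := ‖x' - y'‖ with hR
  have hA : 0 ≤ A := norm_nonneg _
  have hB : 0 ≤ B := norm_nonneg _
  have hC : 0 ≤ C := norm_nonneg _
  have hR0 : 0 ≤ R := norm_nonneg _
  have hRle : R ≤ A + B + C := by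
    have : x' - y' = -(x - x') + (x - y) + (y - y') := by abel
    rw [hR, this]
    refine norm_add₃_le.trans ?_
    rw [norm_neg]
    linarith
  set pen := 3 * α / 2 * (A ^ 2 + B ^ 2) + α / 2 * C ^ 2 with hpen
  have hpen0 : 0 ≤ pen := by positivity
  have hRsq : R ^ 2 ≤ 3 * (A ^ 2 + B ^ 2 + C ^ 2) := by
    have : R ^ 2 ≤ (A + B + C) ^ 2 := by gcongr
    nlinarith [sq_nonneg (A - B), sq_nonneg (A - C), sq_nonneg (B - C)]
  have hαR : α * R ^ 2 ≤ 6 * pen := by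
    have : α * R ^ 2 ≤ α * (3 * (A ^ 2 + B ^ 2 + C ^ 2)) := by gcongr
    have h2 : 0 ≤ α * (A ^ 2 + B ^ 2) := by positivity
    rw [hpen]
    linarith
  have hm := hmax x' hx'
  have hθ1 : min 1 σ ≤ 1 := min_le_left _ _
  have hθ2 : min 1 σ ≤ σ := min_le_right _ _
  have hsum : pen + η * ‖x' - x₀‖ ^ 2 ≤ min 1 σ + (V x' - V y') := by
    rw [hpen]; linarith
  have hη2 : 0 ≤ η * ‖x' - x₀‖ ^ 2 := by positivity
  have hRδ : R < δ := by
    have hv1 := (abs_le.1 (hMv' x' hx')).2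
    have hv2 := (abs_le.1 (hMv' y' hy')).1
    have hM := le_abs_self Mv
    have h1 : α * R ^ 2 ≤ 6 * (1 + 2 * |Mv|) := by linarith
    have h2 : 6 * (1 + 2 * |Mv|) < α * δ ^ 2 := by
      rw [hα, add_mul, div_mul_cancel₀ _ (by positivity)]
      have : 0 < δ ^ 2 := by positivity
      linarith
    exact lt_of_pow_lt_pow_left₀ 2 hδ.le (lt_of_mul_lt_mul_left (h1.trans_lt h2) hα0.le)
  have hVlt := huc x' hx' y' hy' (by rwa [dist_eq_norm])
  rw [Real.dist_eq] at hVlt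
  have hVlt' := (abs_lt.1 hVlt).2
  have hp2 : pen ≤ 2 * σ := by linarith
  have hA2 : 0 ≤ A ^ 2 := sq_nonneg A
  have hB2 : 0 ≤ B ^ 2 := sq_nonneg B
  have hAp : A ^ 2 + B ^ 2 ≤ pen := by
    have h1 : A ^ 2 + B ^ 2 ≤ α * (A ^ 2 + B ^ 2) :=
      le_mul_of_one_le_left (by positivity) hα1
    have h2 : 0 ≤ α * C ^ 2 := by positivity
    rw [hpen]
    linarith
  have hε4 : (0 : ℝ) ≤ ε / 4 := by positivity
  have h1 : ‖x' - x₀‖ ≤ ε / 4 := by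
    refine le_of_sq_le_sq ?_ hε4
    refine le_of_mul_le_mul_left (a := η) ?_ hη
    linarith
  have h2 : A ≤ ε / 4 := le_of_sq_le_sq (by linarith) hε4
  have h3 : B ≤ ε / 4 := le_of_sq_le_sq (by linarith) hε4
  have h4 : R ≤ ε / 4 := by
    refine le_of_sq_le_sq ?_ hε4
    have : R ^ 2 ≤ α * R ^ 2 := le_mul_of_one_le_left (sq_nonneg R) hα1
    linarith
  have h5 : ‖y' - x₀‖ ≤ R + ‖x' - x₀‖ := by
    have : y' - x₀ = -(x' - y') + (x' - x₀) := by abel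
    rw [this]
    refine (norm_add_le _ _).trans ?_
    rw [norm_neg]
  have h6 : ‖x - x₀‖ ≤ A + ‖x' - x₀‖ := by
    have : x - x₀ = (x - x') + (x' - x₀) := by abel
    rw [this]
    exact norm_add_le _ _
  have h7 : ‖y - x₀‖ ≤ B + ‖y' - x₀‖ := by
    have : y - x₀ = (y - y') + (y' - x₀) := by abel
    rw [this]
    exact norm_add_le _ _
  refine ⟨?_, ?_, ?_, ?_, ?_⟩ <;> linarith

variable [InnerProductSpace ℝ E]

lemma isSubgradientSelection_supConv {K : Set E} (hK : IsCompact K) {U : E → ℝ}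
    (hU : ContinuousOn U K) {c : ℝ} {Y : E → E}
    (hY : ∀ x, Y x ∈ K ∧ supConv K U c x = U (Y x) - c * ‖x - Y x‖ ^ 2) :
    IsSubgradientSelection (supConv K U c) (fun x => (2 * c) • (Y x - x)) c := by
  intro x x'
  refine le_trans (le_of_eq ?_) (le_supConv hK hU c x' (hY x).1)
  have h1 : x' - Y x = (x - Y x) + (x' - x) := by abel
  rw [(hY x).2, h1, norm_add_sq_real, inner_smul_left, ← neg_sub x (Y x), inner_neg_left]
  simp
  ring

lemma HasSecondOrderExpansion.le_of_supConv {K : Set E} (hK : IsCompact K) {U : E → ℝ}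
    (hU : ContinuousOn U K) {c : ℝ} {x y a : E} {X : E →L[ℝ] E}
    (h : HasSecondOrderExpansion (supConv K U c) a X x)
    (hy : supConv K U c x = U y - c * ‖x - y‖ ^ 2) {κ : ℝ} (hκ : 0 < κ) :
    ∀ᶠ h in 𝓝 (0 : E), y + h ∈ K →
      U (y + h) ≤ U y + ⟪a, h⟫_ℝ + ⟪X h, h⟫_ℝ / 2 + κ * ‖h‖ ^ 2 := by
  filter_upwards [h κ hκ] with h hh hyh
  have h1 := le_supConv hK hU c (x + h) hyh
  rw [add_sub_add_right_eq_sub] at h1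
  have := (abs_le.1 hh).2
  linarith

lemma IsSubgradientSelection.hessian_ge {u : E → ℝ} {s : E → E} {c : ℝ}
    (hs : IsSubgradientSelection u s c) {a x : E} {X : E →L[ℝ] E}
    (h : HasSecondOrderExpansion u a X x) (h' : E) : -(2 * c * ‖h'‖ ^ 2) ≤ ⟪X h', h'⟫_ℝ := by
  have := nonneg_of_homogeneous (q := fun h => ⟪X h, h⟫_ℝ + 2 * c * ‖h‖ ^ 2)
    (fun t h => by
      simp only [map_smul, inner_smul_left, inner_smul_right, norm_smul, mul_pow,
        Real.norm_eq_abs, sq_abs, RCLike.conj_to_real]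
      ring) (fun κ hκ => ?_) h'
  · linarith
  · have hneg : Tendsto (fun h : E => -h) (𝓝 0) (𝓝 0) := by
      simpa using (continuous_neg (G := E)).tendsto 0
    filter_upwards [h (κ / 2) (by positivity), hneg.eventually (h (κ / 2) (by positivity))]
      with h h1 h2
    have h3 := hs x (x + h)
    have h4 := hs x (x + -h)
    rw [add_sub_cancel_left] at h3 h4
    simp only [map_neg, inner_neg_left, inner_neg_right, norm_neg, neg_neg] at h2 h4
    have := (abs_le.1 h1).2
    have := (abs_le.1 h2).2
    linarith

/-- The doubled functional `(x, y) ↦ u x + v y - α / 2 * ‖x - y‖ ^ 2`. -/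
def doubled (u v : E → ℝ) (α : ℝ) (z : WithLp 2 (E × E)) : ℝ :=
  u z.fst + v z.snd - α / 2 * ‖z.fst - z.snd‖ ^ 2

lemma doubled_add (u v : E → ℝ) (α : ℝ) (z ζ : WithLp 2 (E × E)) :
    doubled u v α (z + ζ) - doubled u v α z =
      (u (z.fst + ζ.fst) - u z.fst) + (v (z.snd + ζ.snd) - v z.snd)
        - α * ⟪z.fst - z.snd, ζ.fst - ζ.snd⟫_ℝ - α / 2 * ‖ζ.fst - ζ.snd‖ ^ 2 := by
  have : (z + ζ).fst - (z + ζ).snd = (z.fst - z.snd) + (ζ.fst - ζ.snd) := by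
    rw [WithLp.add_fst, WithLp.add_snd]; abel
  simp only [doubled]
  rw [this, norm_add_sq_real, WithLp.add_fst, WithLp.add_snd]
  ring

lemma IsSubgradientSelection.doubled {u v : E → ℝ} {a b : E → E} {c α : ℝ} (hα : 0 ≤ α)
    (ha : IsSubgradientSelection u a c) (hb : IsSubgradientSelection v b c) :
    IsSubgradientSelection (doubled u v α)
      (fun z => WithLp.toLp 2 (a z.fst - α • (z.fst - z.snd), b z.snd + α • (z.fst - z.snd)))
      (c + α) := by
  intro z z'
  obtain ⟨ζ, rfl⟩ : ∃ ζ, z' = z + ζ := ⟨z' - z, by abel⟩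
  have h0 := doubled_add u v α z ζ
  have h1 := ha z.fst (z.fst + ζ.fst)
  have h2 := hb z.snd (z.snd + ζ.snd)
  rw [add_sub_cancel_left] at h1 h2 ⊢
  rw [WithLp.prod_inner_apply, WithLp.prod_norm_sq_eq_of_L2]
  change _ + (⟪a z.fst - α • (z.fst - z.snd), ζ.fst⟫_ℝ + ⟪b z.snd + α • (z.fst - z.snd), ζ.snd⟫_ℝ)
    - _ ≤ _
  rw [inner_sub_left, inner_add_left, real_inner_smul_left, real_inner_smul_left]
  rw [inner_sub_right] at h0
  have h4 : α / 2 * ‖ζ.fst - ζ.snd‖ ^ 2 ≤ α / 2 * (2 * (‖ζ.fst‖ ^ 2 + ‖ζ.snd‖ ^ 2)) := by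
    have := parallelogram_law_with_norm ℝ ζ.fst ζ.snd
    gcongr
    nlinarith [sq_nonneg ‖ζ.fst + ζ.snd‖]
  linarith

variable [FiniteDimensional ℝ E]

lemma HasSecondOrderExpansion.exists_fst {u v : E → ℝ} {α : ℝ} {z s : WithLp 2 (E × E)}
    {A : WithLp 2 (E × E) →L[ℝ] WithLp 2 (E × E)}
    (h : HasSecondOrderExpansion (doubled u v α) s A z) :
    ∃ X : E →L[ℝ] E,
      HasSecondOrderExpansion u (s.fst + α • (z.fst - z.snd)) X z.fst := by
  have : CompleteSpace E := FiniteDimensional.complete ℝ E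
  set ι : E →L[ℝ] WithLp 2 (E × E) :=
    ((WithLp.prodContinuousLinearEquiv 2 ℝ E E).symm : (E × E) →L[ℝ] WithLp 2 (E × E)) ∘L
      ContinuousLinearMap.inl ℝ E E with hι
  have hfst : ∀ h, (ι h).fst = h := fun h => rfl
  have hsnd : ∀ h, (ι h).snd = 0 := fun h => rfl
  refine ⟨α • ContinuousLinearMap.id ℝ E + (ContinuousLinearMap.adjoint ι) ∘L A ∘L ι,
    fun κ hκ => ?_⟩
  have hι0 : Tendsto ι (𝓝 0) (𝓝 0) := by simpa using ι.continuous.tendsto 0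
  filter_upwards [hι0.eventually (h κ hκ)] with h hh
  have h1 : ‖ι h‖ ^ 2 = ‖h‖ ^ 2 := by
    rw [WithLp.prod_norm_sq_eq_of_L2, hfst, hsnd]; simp
  have h2 : ⟪s, ι h⟫_ℝ = ⟪s.fst, h⟫_ℝ := by
    rw [WithLp.prod_inner_apply]
    change ⟪s.fst, h⟫_ℝ + ⟪s.snd, (0 : E)⟫_ℝ = _
    simp
  rw [doubled_add, h1, h2, hfst, hsnd, sub_zero, add_zero, sub_self] at hh
  simp only [_root_.add_apply, _root_.smul_apply,
    ContinuousLinearMap.id_apply, ContinuousLinearMap.comp_apply, inner_add_left,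
    real_inner_smul_left, ContinuousLinearMap.adjoint_inner_left, real_inner_self_eq_norm_sq]
  convert hh using 2
  ring

lemma HasSecondOrderExpansion.exists_snd {u v : E → ℝ} {α : ℝ} {z s : WithLp 2 (E × E)}
    {A : WithLp 2 (E × E) →L[ℝ] WithLp 2 (E × E)}
    (h : HasSecondOrderExpansion (doubled u v α) s A z) :
    ∃ X : E →L[ℝ] E,
      HasSecondOrderExpansion v (s.snd - α • (z.fst - z.snd)) X z.snd := by
  have : CompleteSpace E := FiniteDimensional.complete ℝ E
  set ι : E →L[ℝ] WithLp 2 (E × E) :=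
    ((WithLp.prodContinuousLinearEquiv 2 ℝ E E).symm : (E × E) →L[ℝ] WithLp 2 (E × E)) ∘L
      ContinuousLinearMap.inr ℝ E E with hι
  have hfst : ∀ h, (ι h).fst = 0 := fun h => rfl
  have hsnd : ∀ h, (ι h).snd = h := fun h => rfl
  refine ⟨α • ContinuousLinearMap.id ℝ E + (ContinuousLinearMap.adjoint ι) ∘L A ∘L ι,
    fun κ hκ => ?_⟩
  have hι0 : Tendsto ι (𝓝 0) (𝓝 0) := by simpa using ι.continuous.tendsto 0
  filter_upwards [hι0.eventually (h κ hκ)] with h hh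
  have h1 : ‖ι h‖ ^ 2 = ‖h‖ ^ 2 := by
    rw [WithLp.prod_norm_sq_eq_of_L2, hfst, hsnd]; simp
  have h2 : ⟪s, ι h⟫_ℝ = ⟪s.snd, h⟫_ℝ := by
    rw [WithLp.prod_inner_apply]
    change ⟪s.fst, (0 : E)⟫_ℝ + ⟪s.snd, h⟫_ℝ = _
    simp
  rw [doubled_add, h1, h2, hfst, hsnd, zero_sub, add_zero, sub_self, norm_neg,
    inner_neg_right] at hh
  simp only [_root_.add_apply, _root_.smul_apply, inner_sub_left,
    ContinuousLinearMap.id_apply, ContinuousLinearMap.comp_apply, inner_add_left,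
    real_inner_smul_left, ContinuousLinearMap.adjoint_inner_left, real_inner_self_eq_norm_sq]
    at hh ⊢
  convert hh using 2
  ring

omit [FiniteDimensional ℝ E] in
lemma HasSecondOrderExpansion.block_le {u v : E → ℝ} {α : ℝ} {z s : WithLp 2 (E × E)}
    {A : WithLp 2 (E × E) →L[ℝ] WithLp 2 (E × E)}
    (h : HasSecondOrderExpansion (doubled u v α) s A z) (hA : ∀ ζ, ⟪A ζ, ζ⟫_ℝ ≤ 0)
    {X Y : E →L[ℝ] E}
    (hX : HasSecondOrderExpansion u (s.fst + α • (z.fst - z.snd)) X z.fst)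
    (hY : HasSecondOrderExpansion v (s.snd - α • (z.fst - z.snd)) Y z.snd) (h' k' : E) :
    ⟪X h', h'⟫_ℝ + ⟪Y k', k'⟫_ℝ ≤ α * ‖h' - k'‖ ^ 2 := by
  have := nonneg_of_homogeneous (H := WithLp 2 (E × E))
    (q := fun ζ => α * ‖ζ.fst - ζ.snd‖ ^ 2 - ⟪X ζ.fst, ζ.fst⟫_ℝ - ⟪Y ζ.snd, ζ.snd⟫_ℝ)
    (fun t ζ => by
      simp only [WithLp.smul_fst, WithLp.smul_snd, ← smul_sub, map_smul, inner_smul_left,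
        inner_smul_right, norm_smul, mul_pow, Real.norm_eq_abs, sq_abs, RCLike.conj_to_real]
      ring) (fun κ hκ => ?_) (WithLp.toLp 2 (h', k'))
  · change 0 ≤ α * ‖h' - k'‖ ^ 2 - ⟪X h', h'⟫_ℝ - ⟪Y k', k'⟫_ℝ at this
    linarith
  · have hf : Tendsto (fun ζ : WithLp 2 (E × E) => ζ.fst) (𝓝 0) (𝓝 0) :=
      (WithLp.fstL 2 ℝ E E).continuous.tendsto' 0 0 (by simp)
    have hs : Tendsto (fun ζ : WithLp 2 (E × E) => ζ.snd) (𝓝 0) (𝓝 0) :=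
      (WithLp.sndL 2 ℝ E E).continuous.tendsto' 0 0 (by simp)
    filter_upwards [h (κ / 4) (by positivity), hf.eventually (hX (κ / 4) (by positivity)),
      hs.eventually (hY (κ / 4) (by positivity))] with ζ h1 h2 h3
    have h4 := doubled_add u v α z ζ
    have h5 : ⟪s, ζ⟫_ℝ = ⟪s.fst, ζ.fst⟫_ℝ + ⟪s.snd, ζ.snd⟫_ℝ := WithLp.prod_inner_apply _ _
    have h6 := WithLp.prod_norm_sq_eq_of_L2 ζ
    rw [inner_add_left, real_inner_smul_left] at h2
    rw [inner_sub_left, real_inner_smul_left] at h3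
    rw [inner_sub_right] at h4
    have h1' := (abs_le.1 h1).2
    have h2' := (abs_le.1 h2).1
    have h3' := (abs_le.1 h3).1
    have h7 := hA ζ
    rw [h5, h6] at h1'
    rw [h6]
    change _ ≤ κ / 4 * (‖ζ.fst‖ ^ 2 + ‖ζ.snd‖ ^ 2) at h1'
    change -(κ * (‖ζ.fst‖ ^ 2 + ‖ζ.snd‖ ^ 2)) ≤ _
    linarith

/-- The theorem on sums for `U x - V y - α / 2 * ‖x - y‖ ^ 2` near a strict maximum of `U - V`. -/
theorem exists_theorem_on_sums {K : Set E} (hK : IsCompact K) {U V : E → ℝ}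
    (hU : ContinuousOn U K) (hV : ContinuousOn V K) {x₀ : E} (hx₀ : x₀ ∈ K) {η : ℝ} (hη : 0 < η)
    (hmax : ∀ x ∈ K, U x - V x ≤ U x₀ - V x₀ - η * ‖x - x₀‖ ^ 2) {ε : ℝ} (hε : 0 < ε) :
    ∃ α > 0, ∃ x' ∈ K, ∃ y' ∈ K, ‖x' - x₀‖ < ε ∧ ‖y' - x₀‖ < ε ∧
      α * ‖x' - y'‖ ^ 2 + ‖x' - y'‖ < ε ∧ ∃ (a b : E) (X Y : E →L[ℝ] E),
        (∀ h k, ⟪X h, h⟫_ℝ - ⟪Y k, k⟫_ℝ ≤ α * ‖h - k‖ ^ 2) ∧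
        (∀ h, -(3 * α * ‖h‖ ^ 2) ≤ ⟪X h, h⟫_ℝ) ∧ (∀ k, ⟪Y k, k⟫_ℝ ≤ 3 * α * ‖k‖ ^ 2) ∧
        (∀ κ > 0, ∀ᶠ h in 𝓝 (0 : E), x' + h ∈ K →
          U (x' + h) ≤ U x' + ⟪a, h⟫_ℝ + ⟪X h, h⟫_ℝ / 2 + κ * ‖h‖ ^ 2) ∧
        (∀ κ > 0, ∀ᶠ k in 𝓝 (0 : E), y' + k ∈ K →
          V y' + ⟪b, k⟫_ℝ + ⟪Y k, k⟫_ℝ / 2 - κ * ‖k‖ ^ 2 ≤ V (y' + k)) := by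
  obtain ⟨α, hα, θ, hθ, hpen⟩ := exists_penalization hK hV hη hmax hε
  have hne : K.Nonempty := ⟨x₀, hx₀⟩
  have hVn : ContinuousOn (fun x => -V x) K := hV.neg
  choose P hP using exists_supConv_eq hK hne hU (3 * α / 2)
  choose Q hQ using exists_supConv_eq hK hne hVn (3 * α / 2)
  have hsu := isSubgradientSelection_supConv hK hU hP
  have hsv := isSubgradientSelection_supConv hK hVn hQ
  have hsel := hsu.doubled hα.le hsv
  have hcont : Continuous (doubled (supConv K U (3 * α / 2)) (supConv K (fun x => -V x)
      (3 * α / 2)) α) := by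
    have h1 := continuous_supConv hK hU (3 * α / 2)
    have h2 := continuous_supConv hK hVn (3 * α / 2)
    have h3 : Continuous fun z : WithLp 2 (E × E) => z.fst := (WithLp.fstL 2 ℝ E E).continuous
    have h4 : Continuous fun z : WithLp 2 (E × E) => z.snd := (WithLp.sndL 2 ℝ E E).continuous
    unfold doubled
    fun_prop
  have hbase : U x₀ - V x₀ ≤ doubled (supConv K U (3 * α / 2)) (supConv K (fun x => -V x)
      (3 * α / 2)) α (WithLp.toLp 2 (x₀, x₀)) := by
    have h1 := le_supConv hK hU (3 * α / 2) x₀ hx₀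
    have h2 := le_supConv hK hVn (3 * α / 2) x₀ hx₀
    change _ ≤ supConv K U (3 * α / 2) x₀ + supConv K (fun x => -V x) (3 * α / 2) x₀
      - α / 2 * ‖x₀ - x₀‖ ^ 2
    simp only [sub_self, norm_zero] at h1 h2 ⊢
    linarith
  have hclose : ∀ z, doubled (supConv K U (3 * α / 2)) (supConv K (fun x => -V x)
      (3 * α / 2)) α (WithLp.toLp 2 (x₀, x₀)) - θ ≤ doubled (supConv K U (3 * α / 2))
      (supConv K (fun x => -V x) (3 * α / 2)) α z →
      U x₀ - V x₀ - θ ≤ U (P z.fst) - V (Q z.snd) - 3 * α / 2 * (‖z.fst - P z.fst‖ ^ 2 +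
        ‖z.snd - Q z.snd‖ ^ 2) - α / 2 * ‖z.fst - z.snd‖ ^ 2 := by
    intro z hz
    have h3 : doubled (supConv K U (3 * α / 2)) (supConv K (fun x => -V x) (3 * α / 2)) α z =
      supConv K U (3 * α / 2) z.fst + supConv K (fun x => -V x) (3 * α / 2) z.snd
        - α / 2 * ‖z.fst - z.snd‖ ^ 2 := rfl
    have h1 := (hP z.fst).2
    have h2 := (hQ z.snd).2
    linarith
  obtain ⟨z, hz, A, hexp, hA⟩ := hsel.exists_second_order_expansion hcont (by positivity)
    (x₀ := WithLp.toLp 2 (x₀, x₀)) (r := 2 * ε) (by positivity) hθ (by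
      intro z hz
      by_contra! hlt
      obtain ⟨-, -, h1, h2, -⟩ := hpen _ _ _ (hP z.fst).1 _ (hQ z.snd).1 (hclose z hlt.le)
      have h3 : ‖z - WithLp.toLp 2 (x₀, x₀)‖ ^ 2 = ‖z.fst - x₀‖ ^ 2 + ‖z.snd - x₀‖ ^ 2 :=
        WithLp.prod_norm_sq_eq_of_L2 _
      have h4 : (2 * ε) ^ 2 ≤ ‖z - WithLp.toLp 2 (x₀, x₀)‖ ^ 2 := by gcongr
      have h5 : ‖z.fst - x₀‖ ^ 2 ≤ ε ^ 2 := by gcongr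
      have h6 : ‖z.snd - x₀‖ ^ 2 ≤ ε ^ 2 := by gcongr
      nlinarith)
  obtain ⟨h1, h2, -, -, h5⟩ := hpen _ _ _ (hP z.fst).1 _ (hQ z.snd).1 (hclose z hz)
  obtain ⟨X, hX⟩ := hexp.exists_fst
  obtain ⟨Y, hY⟩ := hexp.exists_snd
  obtain ⟨b, hb⟩ : ∃ b, HasSecondOrderExpansion (supConv K (fun x => -V x) (3 * α / 2)) b Y z.snd :=
    ⟨_, hY⟩
  refine ⟨α, hα, _, (hP z.fst).1, _, (hQ z.snd).1, h1, h2, h5, _, -b, X, -Y, fun h k => ?_,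
    fun h => ?_, fun k => ?_, fun κ hκ => hX.le_of_supConv hK hU (hP z.fst).2 hκ, fun κ hκ => ?_⟩
  · have := hexp.block_le hA hX hY h k
    rwa [_root_.neg_apply, inner_neg_left, sub_neg_eq_add]
  · have := hsu.hessian_ge hX h
    linarith
  · have := hsv.hessian_ge hY k
    rw [_root_.neg_apply, inner_neg_left]
    linarith
  · filter_upwards [hb.le_of_supConv hK hVn (hQ z.snd).2 hκ] with k hk hkK
    have := hk hkK
    rw [_root_.neg_apply, inner_neg_left, inner_neg_left]
    linarith

end TheoremOnSums

section QuadraticTestFunctions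

variable {N : ℕ}

/-- The symmetric matrix of the quadratic form `h ↦ ⟪L h, h⟫`. -/
def symMat (L : Euc N →L[ℝ] Euc N) : Matrix (Fin N) (Fin N) ℝ :=
  Matrix.of fun i j =>
    (⟪L (EuclideanSpace.single i 1), EuclideanSpace.single j 1⟫_ℝ +
      ⟪L (EuclideanSpace.single j 1), EuclideanSpace.single i 1⟫_ℝ) / 2

lemma symMat_isSymm (L : Euc N →L[ℝ] Euc N) : (symMat L).IsSymm := by
  ext i j
  simp only [symMat, Matrix.transpose_apply, Matrix.of_apply]
  ring

lemma symMat_add (L M : Euc N →L[ℝ] Euc N) : symMat (L + M) = symMat L + symMat M := by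
  ext i j
  simp only [symMat, Matrix.add_apply, Matrix.of_apply, _root_.add_apply, inner_add_left]
  ring

lemma symMat_smul (t : ℝ) (L : Euc N →L[ℝ] Euc N) : symMat (t • L) = t • symMat L := by
  ext i j
  simp only [symMat, Matrix.smul_apply, Matrix.of_apply, _root_.smul_apply, real_inner_smul_left,
    smul_eq_mul]
  ring

lemma dotProduct_symMat_mulVec (L : Euc N →L[ℝ] Euc N) (ξ : Fin N → ℝ) :
    ξ ⬝ᵥ symMat L *ᵥ ξ = ⟪L (WithLp.toLp 2 ξ), WithLp.toLp 2 ξ⟫_ℝ := by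
  have hξ : WithLp.toLp 2 ξ = ∑ i, ξ i • (EuclideanSpace.single i 1 : Euc N) := by
    ext j
    simp [Pi.single_apply]
  have h1 : ⟪L (WithLp.toLp 2 ξ), WithLp.toLp 2 ξ⟫_ℝ = ∑ i, ∑ j, ξ i * ξ j *
      ⟪L (EuclideanSpace.single i 1), EuclideanSpace.single j 1⟫_ℝ := by
    rw [hξ, map_sum, sum_inner]
    refine Finset.sum_congr rfl fun i _ => ?_
    rw [inner_sum]
    refine Finset.sum_congr rfl fun j _ => ?_
    rw [map_smul, real_inner_smul_left, real_inner_smul_right]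
    ring
  have h2 : ξ ⬝ᵥ symMat L *ᵥ ξ = ∑ i, ∑ j, (ξ i * ξ j *
      ⟪L (EuclideanSpace.single i 1), EuclideanSpace.single j 1⟫_ℝ / 2 + ξ j * ξ i *
      ⟪L (EuclideanSpace.single j 1), EuclideanSpace.single i 1⟫_ℝ / 2) := by
    simp only [dotProduct, Matrix.mulVec, Finset.mul_sum, symMat, Matrix.of_apply]
    refine Finset.sum_congr rfl fun i _ => Finset.sum_congr rfl fun j _ => ?_
    ring
  rw [h1, h2]
  simp only [Finset.sum_add_distrib]
  rw [Finset.sum_comm (f := fun i j => ξ j * ξ i *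
    ⟪L (EuclideanSpace.single j 1), EuclideanSpace.single i 1⟫_ℝ / 2)]
  simp only [← Finset.sum_add_distrib]
  refine Finset.sum_congr rfl fun i _ => Finset.sum_congr rfl fun j _ => ?_
  ring

lemma symMat_posSemidef {L : Euc N →L[ℝ] Euc N} (hL : ∀ h, 0 ≤ ⟪L h, h⟫_ℝ) :
    (symMat L).PosSemidef := by
  refine Matrix.PosSemidef.of_dotProduct_mulVec_nonneg ?_ fun ξ => ?_
  · have := symMat_isSymm L
    rwa [Matrix.IsHermitian, Matrix.conjTranspose_eq_transpose_of_trivial]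
  · rw [star_trivial, dotProduct_symMat_mulVec]
    exact hL _

lemma trace_symMat_id : (symMat (ContinuousLinearMap.id ℝ (Euc N))).trace = N := by
  simp [Matrix.trace, symMat]

/-- The rank-one operator `h ↦ ⟪d, h⟫ d`. -/
def rankOneSq (d : Euc N) : Euc N →L[ℝ] Euc N := (innerSL ℝ d).smulRight d

lemma inner_rankOneSq (d h : Euc N) : ⟪rankOneSq d h, h⟫_ℝ = ⟪d, h⟫_ℝ ^ 2 := by
  simp [rankOneSq, real_inner_smul_left, sq]

lemma trace_symMat_rankOneSq (d : Euc N) : (symMat (rankOneSq d)).trace = ‖d‖ ^ 2 := by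
  simp only [Matrix.trace, Matrix.diag, symMat, Matrix.of_apply, inner_rankOneSq]
  simp [EuclideanSpace.norm_sq_eq, EuclideanSpace.inner_single_right]

lemma hessianMatrix_quadratic (c : ℝ) (a x : Euc N) (L : Euc N →L[ℝ] Euc N) :
    hessianMatrix (fun z => c + ⟪a, z - x⟫_ℝ + ⟪L (z - x), z - x⟫_ℝ / 2) x = symMat L := by
  obtain ⟨B, hB⟩ : ∃ B : Euc N →L[ℝ] Euc N →L[ℝ] ℝ,
      ∀ v w, B v w = (⟪L v, w⟫_ℝ + ⟪L w, v⟫_ℝ) / 2 := by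
    let G : Euc N →L[ℝ] Euc N →L[ℝ] ℝ := innerSL ℝ
    refine ⟨(1 / 2 : ℝ) • (G.comp L + (G.comp L).flip), fun v w => ?_⟩
    change 1 / 2 * (⟪L v, w⟫_ℝ + ⟪L w, v⟫_ℝ) = _
    ring
  have h1 : ∀ z, HasFDerivAt (fun z => c + ⟪a, z - x⟫_ℝ + ⟪L (z - x), z - x⟫_ℝ / 2)
      (innerSL ℝ a + B (z - x)) z := by
    intro z
    have hz : HasFDerivAt (fun z => z - x) (ContinuousLinearMap.id ℝ (Euc N)) z :=
      (hasFDerivAt_id z).sub_const x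
    have hLz : HasFDerivAt (fun z => L (z - x)) (L.comp (ContinuousLinearMap.id ℝ (Euc N))) z :=
      L.hasFDerivAt.comp z hz
    have := ((((innerSL ℝ a).hasFDerivAt.comp z hz).const_add c)).add
      ((hLz.inner ℝ hz).mul_const (1 / 2 : ℝ))
    refine (this.congr_fderiv ?_).congr_of_eventuallyEq (.of_forall fun w => ?_)
    · ext v
      change ⟪a, v⟫_ℝ + 1 / 2 * fderivInnerCLM ℝ (L (z - x), z - x) (L v, v) =
        ⟪a, v⟫_ℝ + B (z - x) v
      rw [hB, fderivInnerCLM_apply]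
      ring
    · simp [div_eq_mul_inv]
  have h2 : fderiv ℝ (fun z => c + ⟪a, z - x⟫_ℝ + ⟪L (z - x), z - x⟫_ℝ / 2) =
      fun z => innerSL ℝ a + B (z - x) := funext fun z => (h1 z).fderiv
  have h3 : HasFDerivAt (fun z => innerSL ℝ a + B (z - x)) B x := by
    have := (B.hasFDerivAt.comp x ((hasFDerivAt_id x).sub_const x)).const_add (innerSL ℝ a)
    simpa using this
  ext i j
  rw [hessianMatrix, Matrix.of_apply, iteratedFDeriv_two_apply, h2, h3.fderiv, hB, symMat,
    Matrix.of_apply]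
  rfl

lemma contDiff_quadratic (c : ℝ) (a x : Euc N) (L : Euc N →L[ℝ] Euc N) :
    ContDiff ℝ 2 (fun z => c + ⟪a, z - x⟫_ℝ + ⟪L (z - x), z - x⟫_ℝ / 2) := by
  have h1 : ContDiff ℝ 2 fun z : Euc N => z - x := contDiff_id.sub contDiff_const
  exact (contDiff_const.add (contDiff_const.inner ℝ h1)).add
    (((L.contDiff.comp h1).inner ℝ h1).div_const 2)

/-- `u` satisfies `F(x, D²u) + g ≥ 0` in `Ω` in the viscosity sense, tested with quadratic
polynomials. -/
def QuadSubsol (Ω : Set (Euc N)) (F : Euc N → Matrix (Fin N) (Fin N) ℝ → ℝ) (g u : Euc N → ℝ) :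
    Prop :=
  ∀ x ∈ Ω, ∀ (a : Euc N) (L : Euc N →L[ℝ] Euc N),
    (∀ᶠ h in 𝓝 0, u (x + h) ≤ u x + ⟪a, h⟫_ℝ + ⟪L h, h⟫_ℝ / 2) → 0 ≤ F x (symMat L) + g x

/-- `u` satisfies `F(x, D²u) + g ≤ 0` in `Ω` in the viscosity sense, tested with quadratic
polynomials. -/
def QuadSupersol (Ω : Set (Euc N)) (F : Euc N → Matrix (Fin N) (Fin N) ℝ → ℝ) (g u : Euc N → ℝ) :
    Prop :=
  ∀ x ∈ Ω, ∀ (a : Euc N) (L : Euc N →L[ℝ] Euc N),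
    (∀ᶠ h in 𝓝 0, u x + ⟪a, h⟫_ℝ + ⟪L h, h⟫_ℝ / 2 ≤ u (x + h)) → F x (symMat L) + g x ≤ 0

lemma tendsto_sub_self_nhds_zero (x : Euc N) : Tendsto (fun z => z - x) (𝓝 x) (𝓝 0) :=
  (continuous_id.sub continuous_const).tendsto' x 0 (sub_self x)

lemma ViscSubsol.quadSubsol {Ω : Set (Euc N)} {F : Euc N → Matrix (Fin N) (Fin N) ℝ → ℝ}
    {μ p : ℝ} {k u : Euc N → ℝ} (h : ViscSubsol Ω (logisticG F μ k p) u) :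
    QuadSubsol Ω F (fun x => μ * u x - k x * u x ^ p) u := by
  intro x hx a L hL
  have := h x hx _ (contDiff_quadratic (u x) a x L) (by simp) (by
    refine eventually_nhdsWithin_of_eventually_nhds ?_
    filter_upwards [(tendsto_sub_self_nhds_zero x).eventually hL] with z hz
    rw [add_sub_cancel] at hz
    simp only [sub_self, inner_zero_right, zero_div, add_zero]
    linarith)
  rw [hessianMatrix_quadratic, logisticG] at this
  change 0 ≤ _ + μ * u x - k x * u x ^ p at this
  linarith

lemma ViscSupersol.quadSupersol {Ω : Set (Euc N)} {F : Euc N → Matrix (Fin N) (Fin N) ℝ → ℝ}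
    {μ p : ℝ} {k u : Euc N → ℝ} (h : ViscSupersol Ω (logisticG F μ k p) u) :
    QuadSupersol Ω F (fun x => μ * u x - k x * u x ^ p) u := by
  intro x hx a L hL
  have := h x hx _ (contDiff_quadratic (u x) a x L) (by simp) (by
    refine eventually_nhdsWithin_of_eventually_nhds ?_
    filter_upwards [(tendsto_sub_self_nhds_zero x).eventually hL] with z hz
    rw [add_sub_cancel] at hz
    simp only [sub_self, inner_zero_right, zero_div, add_zero]
    linarith)
  rw [hessianMatrix_quadratic, logisticG] at this
  change _ + μ * u x - k x * u x ^ p ≤ 0 at this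
  linarith

lemma QuadSupersol.const_mul {Ω : Set (Euc N)} {F : Euc N → Matrix (Fin N) (Fin N) ℝ → ℝ}
    (hF2 : IsF2 Ω F) {g u : Euc N → ℝ} (h : QuadSupersol Ω F g u) {τ : ℝ} (hτ : 0 < τ) :
    QuadSupersol Ω F (fun x => τ * g x) (fun x => τ * u x) := by
  intro x hx a L hL
  have h1 := h x hx (τ⁻¹ • a) (τ⁻¹ • L) (by
    filter_upwards [hL] with z hz
    rw [_root_.smul_apply, real_inner_smul_left, real_inner_smul_left]
    have := mul_le_mul_of_nonneg_left hz (inv_pos.2 hτ).le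
    rw [inv_mul_cancel_left₀ hτ.ne'] at this
    refine le_trans (le_of_eq ?_) this
    field_simp)
  have h2 := hF2 x hx τ hτ.le (symMat (τ⁻¹ • L))
  rw [← symMat_smul, smul_inv_smul₀ hτ.ne'] at h2
  simp only [h2]
  nlinarith

end QuadraticTestFunctions

section DifferenceOfSolutions

variable {N : ℕ}

lemma isHermitian_fromBlocks_of_isSymm {A B D : Matrix (Fin N) (Fin N) ℝ} (hA : A.IsSymm)
    (hB : B.IsSymm) (hD : D.IsSymm) : (Matrix.fromBlocks A B B D).IsHermitian := by
  rw [Matrix.IsHermitian, Matrix.conjTranspose_eq_transpose_of_trivial, Matrix.fromBlocks_transpose,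
    hA.eq, hB.eq, hD.eq]

lemma dotProduct_self_eq_norm_sq (ξ : Fin N → ℝ) : ξ ⬝ᵥ ξ = ‖(WithLp.toLp 2 ξ : Euc N)‖ ^ 2 := by
  rw [EuclideanSpace.norm_sq_eq]
  simp [dotProduct, sq]

lemma matLE_fromBlocks_symMat {X Y : Euc N →L[ℝ] Euc N} {β : ℝ}
    (hX : ∀ h, -(β * ‖h‖ ^ 2) ≤ ⟪X h, h⟫_ℝ) (hY : ∀ k, ⟪Y k, k⟫_ℝ ≤ β * ‖k‖ ^ 2) :
    MatLE ((-β) • (1 : Matrix (Fin N ⊕ Fin N) (Fin N ⊕ Fin N) ℝ))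
      (Matrix.fromBlocks (symMat X) 0 0 (-symMat Y)) := by
  refine Matrix.PosSemidef.of_dotProduct_mulVec_nonneg ?_ fun ξ => ?_
  · refine (isHermitian_fromBlocks_of_isSymm (symMat_isSymm X) Matrix.isSymm_zero
      (symMat_isSymm Y).neg).sub ?_
    rw [Matrix.IsHermitian, Matrix.conjTranspose_smul, Matrix.conjTranspose_one, star_trivial]
  · obtain ⟨h, k, rfl⟩ : ∃ h k, ξ = Sum.elim h k := ⟨_, _, (Sum.elim_comp_inl_inr ξ).symm⟩
    rw [star_trivial, Matrix.sub_mulVec, Matrix.smul_mulVec, Matrix.one_mulVec,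
      Matrix.fromBlocks_mulVec, Sum.elim_comp_inl, Sum.elim_comp_inr, Matrix.zero_mulVec,
      Matrix.zero_mulVec, add_zero, zero_add, dotProduct_sub, dotProduct_smul,
      sumElim_dotProduct_sumElim, sumElim_dotProduct_sumElim, Matrix.neg_mulVec, dotProduct_neg,
      dotProduct_symMat_mulVec, dotProduct_symMat_mulVec, dotProduct_self_eq_norm_sq,
      dotProduct_self_eq_norm_sq, smul_eq_mul]
    have := hX (WithLp.toLp 2 h)
    have := hY (WithLp.toLp 2 k)
    linarith

lemma fromBlocks_symMat_matLE {X Y : Euc N →L[ℝ] Euc N} {α : ℝ} (hα : 0 ≤ α)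
    (hXY : ∀ h k, ⟪X h, h⟫_ℝ - ⟪Y k, k⟫_ℝ ≤ α * ‖h - k‖ ^ 2) :
    MatLE (Matrix.fromBlocks (symMat X) 0 0 (-symMat Y))
      ((3 * α) • Matrix.fromBlocks 1 (-1) (-1) 1) := by
  refine Matrix.PosSemidef.of_dotProduct_mulVec_nonneg ?_ fun ξ => ?_
  · refine Matrix.IsHermitian.sub ?_ (isHermitian_fromBlocks_of_isSymm (symMat_isSymm X)
      Matrix.isSymm_zero (symMat_isSymm Y).neg)
    rw [Matrix.IsHermitian, Matrix.conjTranspose_smul, star_trivial,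
      (isHermitian_fromBlocks_of_isSymm Matrix.isSymm_one Matrix.isSymm_one.neg
        Matrix.isSymm_one).eq]
  · obtain ⟨h, k, rfl⟩ : ∃ h k, ξ = Sum.elim h k := ⟨_, _, (Sum.elim_comp_inl_inr ξ).symm⟩
    rw [star_trivial, Matrix.sub_mulVec, Matrix.smul_mulVec,
      Matrix.fromBlocks_mulVec, Matrix.fromBlocks_mulVec, Sum.elim_comp_inl, Sum.elim_comp_inr,
      Matrix.zero_mulVec, Matrix.zero_mulVec, add_zero, zero_add, dotProduct_sub, dotProduct_smul,
      sumElim_dotProduct_sumElim, sumElim_dotProduct_sumElim, Matrix.neg_mulVec,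
      Matrix.neg_mulVec, Matrix.neg_mulVec, dotProduct_neg k,
      dotProduct_symMat_mulVec, dotProduct_symMat_mulVec,
      Matrix.one_mulVec, Matrix.one_mulVec, smul_eq_mul]
    have h1 : h ⬝ᵥ (h + -k) + k ⬝ᵥ (-h + k) = ‖(WithLp.toLp 2 h - WithLp.toLp 2 k : Euc N)‖ ^ 2 := by
      have h2 : -h + k = -(h - k) := by abel
      rw [← WithLp.toLp_sub, ← dotProduct_self_eq_norm_sq, sub_dotProduct, h2, dotProduct_neg,
        ← sub_eq_add_neg, ← sub_eq_add_neg]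
    rw [h1]
    have := hXY (WithLp.toLp 2 h) (WithLp.toLp 2 k)
    have : 0 ≤ α * ‖(WithLp.toLp 2 h - WithLp.toLp 2 k : Euc N)‖ ^ 2 := by positivity
    linarith

lemma IsF1.symMat_add_smul_id_le {Ω : Set (Euc N)} {F : Euc N → Matrix (Fin N) (Fin N) ℝ → ℝ}
    {lam Lam : ℝ} (hF1 : IsF1 Ω F lam Lam) {x : Euc N} (hx : x ∈ Ω) (L : Euc N →L[ℝ] Euc N)
    {c : ℝ} (hc : 0 ≤ c) :
    F x (symMat (L + c • ContinuousLinearMap.id ℝ (Euc N))) ≤ F x (symMat L) + Lam * (N * c) := by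
  have := (hF1.2.2 x hx (symMat L) (symMat (c • ContinuousLinearMap.id ℝ (Euc N)))
    (symMat_isSymm L) (symMat_posSemidef fun h => by
      rw [_root_.smul_apply, real_inner_smul_left]
      exact mul_nonneg hc real_inner_self_nonneg)).2
  rw [symMat_smul, Matrix.trace_smul, trace_symMat_id, ← symMat_smul, ← symMat_add,
    smul_eq_mul] at this
  linarith

lemma IsF1.le_symMat_add_rankOneSq {Ω : Set (Euc N)} {F : Euc N → Matrix (Fin N) (Fin N) ℝ → ℝ}
    {lam Lam : ℝ} (hF1 : IsF1 Ω F lam Lam) {x : Euc N} (hx : x ∈ Ω) (L : Euc N →L[ℝ] Euc N)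
    {b : ℝ} (hb : 0 ≤ b) (d : Euc N) :
    F x (symMat L) + lam * (b * ‖d‖ ^ 2) ≤ F x (symMat (L + b • rankOneSq d)) := by
  have := (hF1.2.2 x hx (symMat L) (symMat (b • rankOneSq d))
    (symMat_isSymm L) (symMat_posSemidef fun h => by
      rw [_root_.smul_apply, real_inner_smul_left, inner_rankOneSq]
      positivity)).1
  rw [symMat_smul, Matrix.trace_smul, trace_symMat_rankOneSq, ← symMat_smul, ← symMat_add,
    smul_eq_mul] at this
  linarith

lemma exists_difference_test {Ω : Set (Euc N)} (hΩ : IsOpen Ω)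
    {F : Euc N → Matrix (Fin N) (Fin N) ℝ → ℝ} {lam Lam : ℝ} (hF1 : IsF1 Ω F lam Lam) {ω : ℝ → ℝ}
    (hmono : Monotone ω)
    (hω : ∀ α : ℝ, 0 < α → ∀ x ∈ Ω, ∀ y ∈ Ω, ∀ X Y : Matrix (Fin N) (Fin N) ℝ,
      X.IsSymm → Y.IsSymm →
      MatLE ((-(3 * α)) • (1 : Matrix (Fin N ⊕ Fin N) (Fin N ⊕ Fin N) ℝ))
        (Matrix.fromBlocks X 0 0 (-Y)) →
      MatLE (Matrix.fromBlocks X 0 0 (-Y))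
        ((3 * α) • Matrix.fromBlocks 1 (-1) (-1) 1) →
      F x X - F y Y ≤ ω (α * ‖x - y‖ ^ 2 + ‖x - y‖))
    {U V g₁ g₂ : Euc N → ℝ} (hU : ContinuousOn U Ω) (hV : ContinuousOn V Ω)
    (hsub : QuadSubsol Ω F g₂ U) (hsup : QuadSupersol Ω F g₁ V) {x₀ : Euc N} (hx₀ : x₀ ∈ Ω)
    {a d : Euc N} {b c : ℝ} (hb : 0 ≤ b) (hc : 0 ≤ c)
    (htouch : ∀ᶠ h in 𝓝 (0 : Euc N), U (x₀ + h) - V (x₀ + h) ≤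
      U x₀ - V x₀ + ⟪a, h⟫_ℝ + c / 2 * ‖h‖ ^ 2 - b / 2 * ⟪d, h⟫_ℝ ^ 2)
    {η ε : ℝ} (hη : 0 < η) (hε : 0 < ε) :
    ∃ x' y', ‖x' - x₀‖ < ε ∧ ‖y' - x₀‖ < ε ∧
      0 ≤ ω ε + Lam * (N * (c + 6 * η)) - lam * (b * ‖d‖ ^ 2) + g₂ x' - g₁ y' := by
  have hΩx : ∀ᶠ h in 𝓝 (0 : Euc N), x₀ + h ∈ Ω :=
    ((continuous_const.add continuous_id).tendsto' 0 x₀ (add_zero x₀)).eventually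
      (hΩ.mem_nhds hx₀)
  obtain ⟨r, hr, hball⟩ := Metric.eventually_nhds_iff_ball.1 (htouch.and hΩx)
  set K := closedBall x₀ (r / 2) with hK
  have hball' : ∀ x ∈ K, U x - V x ≤ U x₀ - V x₀ + ⟪a, x - x₀⟫_ℝ + c / 2 * ‖x - x₀‖ ^ 2
      - b / 2 * ⟪d, x - x₀⟫_ℝ ^ 2 ∧ x ∈ Ω := by
    intro x hx
    have := hball (x - x₀) (by
      rw [mem_ball_zero_iff, ← dist_eq_norm]
      linarith [mem_closedBall.1 hx])
    rwa [add_sub_cancel] at this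
  have hKΩ : K ⊆ Ω := fun x hx => (hball' x hx).2
  set ρ : Euc N → ℝ := fun x => ⟪a, x - x₀⟫_ℝ + (c / 2 + η) * ‖x - x₀‖ ^ 2
    - b / 2 * ⟪d, x - x₀⟫_ℝ ^ 2 with hρ
  have hρc : Continuous ρ := by fun_prop
  have hx₀K : x₀ ∈ K := mem_closedBall_self (by positivity)
  have hρ0 : ρ x₀ = 0 := by simp [hρ]
  obtain ⟨α, hα, x', hx', y', hy', hx'ε, hy'ε, hαε, a', b', X, Y, hXY, hXge, hYle, hUx, hVy⟩ :=
    exists_theorem_on_sums (isCompact_closedBall x₀ (r / 2)) (U := fun x => U x - ρ x)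
      ((hU.mono hKΩ).sub hρc.continuousOn) (hV.mono hKΩ) hx₀K hη (fun x hx => by
        have := (hball' x hx).1
        simp only [hρ0, sub_zero]
        simp only [hρ]
        linarith) (lt_min hε (half_pos hr))
  have hnear : ∀ z, ‖z - x₀‖ < min ε (r / 2) → ∀ᶠ h in 𝓝 (0 : Euc N), z + h ∈ K := by
    intro z hz
    refine ((continuous_const.add continuous_id).tendsto' 0 z (add_zero z)).eventually
      (closedBall_mem_nhds_of_mem ?_)
    rw [mem_ball, dist_eq_norm]
    exact hz.trans_le (min_le_right _ _)
  have hx'Ω := hKΩ hx'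
  have hy'Ω := hKΩ hy'
  refine ⟨x', y', hx'ε.trans_le (min_le_left _ _), hy'ε.trans_le (min_le_left _ _), ?_⟩
  have h1 := hsub x' hx'Ω (a' + a + (c + 2 * η) • (x' - x₀) - (b * ⟪d, x' - x₀⟫_ℝ) • d)
    ((X - b • rankOneSq d) + (c + 4 * η) • ContinuousLinearMap.id ℝ (Euc N)) (by
      filter_upwards [hUx η hη, hnear x' hx'ε] with h h1 h2
      have h3 := h1 h2
      have h4 : ρ (x' + h) = ρ x' + ⟪a, h⟫_ℝ + (c + 2 * η) * ⟪x' - x₀, h⟫_ℝ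
          + (c / 2 + η) * ‖h‖ ^ 2 - b * ⟪d, x' - x₀⟫_ℝ * ⟪d, h⟫_ℝ - b / 2 * ⟪d, h⟫_ℝ ^ 2 := by
        simp only [hρ, add_sub_right_comm, inner_add_right, norm_add_sq_real]
        ring
      simp only [inner_add_left, inner_sub_left, real_inner_smul_left, _root_.add_apply,
        _root_.sub_apply, _root_.smul_apply, inner_rankOneSq, ContinuousLinearMap.id_apply,
        real_inner_self_eq_norm_sq] at h3 ⊢
      rw [inner_sub_left] at h4
      linarith)
  have h2 := hsup y' hy'Ω b' (Y - (2 * η) • ContinuousLinearMap.id ℝ (Euc N)) (by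
      filter_upwards [hVy η hη, hnear y' hy'ε] with h h1 h2
      have h3 := h1 h2
      simp only [inner_sub_left, real_inner_smul_left, _root_.sub_apply,
        _root_.smul_apply, ContinuousLinearMap.id_apply, real_inner_self_eq_norm_sq]
      linarith)
  have h3 := hF1.symMat_add_smul_id_le hx'Ω (X - b • rankOneSq d) (c := c + 4 * η) (by positivity)
  have h4 := hF1.le_symMat_add_rankOneSq hx'Ω (X - b • rankOneSq d) hb d
  rw [sub_add_cancel] at h4
  have h5 := hF1.symMat_add_smul_id_le hy'Ω (Y - (2 * η) • ContinuousLinearMap.id ℝ (Euc N))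
    (c := 2 * η) (by positivity)
  rw [sub_add_cancel] at h5
  have h6 := hω α hα x' hx'Ω y' hy'Ω (symMat X) (symMat Y) (symMat_isSymm X) (symMat_isSymm Y)
    (matLE_fromBlocks_symMat hXge hYle) (fromBlocks_symMat_matLE hα.le hXY)
  have h7 := hmono (hαε.le.trans (min_le_left _ _))
  linarith

/-- If `U - V` is touched from above at `x₀` by a quadratic polynomial whose Hessian is `c` times
the identity minus a rank-one part, then the difference of the two equations holds at `x₀`. -/
lemma difference_test {Ω : Set (Euc N)} (hΩ : IsOpen Ω)
    {F : Euc N → Matrix (Fin N) (Fin N) ℝ → ℝ} {lam Lam : ℝ} (hF1 : IsF1 Ω F lam Lam)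
    (hF3 : IsF3 Ω F)
    {U V g₁ g₂ : Euc N → ℝ} (hU : ContinuousOn U Ω) (hV : ContinuousOn V Ω)
    (hg₁ : ContinuousOn g₁ Ω) (hg₂ : ContinuousOn g₂ Ω)
    (hsub : QuadSubsol Ω F g₂ U) (hsup : QuadSupersol Ω F g₁ V) {x₀ : Euc N} (hx₀ : x₀ ∈ Ω)
    {a d : Euc N} {b c : ℝ} (hb : 0 ≤ b) (hc : 0 ≤ c)
    (htouch : ∀ᶠ h in 𝓝 (0 : Euc N), U (x₀ + h) - V (x₀ + h) ≤
      U x₀ - V x₀ + ⟪a, h⟫_ℝ + c / 2 * ‖h‖ ^ 2 - b / 2 * ⟪d, h⟫_ℝ ^ 2) :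
    0 ≤ Lam * (N * c) - lam * (b * ‖d‖ ^ 2) + g₂ x₀ - g₁ x₀ := by
  obtain ⟨ω, hmono, hω0, hωc, -, hω⟩ := hF3
  have hLam : 0 < Lam := hF1.1.trans_le hF1.2.1
  refine le_of_forall_pos_le_add fun e he => ?_
  have hω' : Tendsto ω (𝓝 0) (𝓝 0) := by simpa [ContinuousAt, hω0] using hωc
  obtain ⟨ε₀, hε₀, hωε⟩ := Metric.eventually_nhds_iff.1 (hω'.eventually (gt_mem_nhds
    (show (0 : ℝ) < e / 4 by positivity)))
  obtain ⟨ε₁, hε₁, h1⟩ := Metric.continuousAt_iff.1 (hg₁.continuousAt (hΩ.mem_nhds hx₀)) (e / 4)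
    (by positivity)
  obtain ⟨ε₂, hε₂, h2⟩ := Metric.continuousAt_iff.1 (hg₂.continuousAt (hΩ.mem_nhds hx₀)) (e / 4)
    (by positivity)
  set ε := min (ε₀ / 2) (min ε₁ ε₂)
  have hε : 0 < ε := lt_min (by positivity) (lt_min hε₁ hε₂)
  set η := e / (24 * (Lam * (N + 1)))
  have hη : 0 < η := by positivity
  obtain ⟨x', y', hx', hy', h3⟩ := exists_difference_test hΩ hF1 hmono hω hU hV hsub hsup hx₀ hb hc
    htouch hη hε
  have h4 : ω ε < e / 4 := hωε (by
    rw [Real.dist_eq, sub_zero, abs_of_pos hε]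
    exact (min_le_left _ _).trans_lt (half_lt_self hε₀))
  have h5 := h1 (x := y') (by
    rw [dist_eq_norm]
    exact hy'.trans_le ((min_le_right _ _).trans (min_le_left _ _)))
  have h6 := h2 (x := x') (by
    rw [dist_eq_norm]
    exact hx'.trans_le ((min_le_right _ _).trans (min_le_right _ _)))
  rw [Real.dist_eq] at h5 h6
  have h7 : 24 * (Lam * (N * η)) ≤ e := by
    have : 24 * (Lam * (N + 1)) * η = e := mul_div_cancel₀ _ (by positivity)
    have : 0 < Lam * η := by positivity
    linarith
  have := (abs_lt.1 h5).1
  have := (abs_lt.1 h6).2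
  linarith

end DifferenceOfSolutions

section MaximumPrinciple

variable {N : ℕ}

lemma tendsto_const_add_nhds_zero (x : Euc N) : Tendsto (fun h => x + h) (𝓝 0) (𝓝 x) :=
  (continuous_const.add continuous_id).tendsto' 0 x (add_zero x)

/-- The difference of the two equations at an interior maximum of `U - V + B * f ^ 2`. -/
lemma barrier_test {Ω : Set (Euc N)} (hΩ : IsOpen Ω)
    {F : Euc N → Matrix (Fin N) (Fin N) ℝ → ℝ} {lam Lam : ℝ} (hF1 : IsF1 Ω F lam Lam)
    (hF3 : IsF3 Ω F)
    {U V g₁ g₂ : Euc N → ℝ} (hU : ContinuousOn U Ω) (hV : ContinuousOn V Ω)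
    (hg₁ : ContinuousOn g₁ Ω) (hg₂ : ContinuousOn g₂ Ω)
    (hsub : QuadSubsol Ω F g₂ U) (hsup : QuadSupersol Ω F g₁ V) {x : Euc N} (hx : x ∈ Ω)
    {f : Euc N → ℝ} {d : Euc N} {B C : ℝ} (hB : 0 ≤ B) (hC : 0 ≤ C)
    (hf : ∀ᶠ h in 𝓝 (0 : Euc N), |f (x + h) - f x - ⟪d, h⟫_ℝ| ≤ C * ‖h‖ ^ 2)
    (hmax : ∀ᶠ y in 𝓝 x, U y - V y + B * f y ^ 2 ≤ U x - V x + B * f x ^ 2) :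
    0 ≤ 4 * Lam * N * B * C * |f x| - 2 * lam * B * ‖d‖ ^ 2 + g₂ x - g₁ x := by
  have hLam : 0 < Lam := hF1.1.trans_le hF1.2.1
  refine le_of_forall_pos_le_add fun e he => ?_
  set D := 4 * Lam * N * B * C with hD
  have hD0 : 0 ≤ D := by positivity
  set κ := e / (D + 1) with hκ
  have hκ0 : 0 < κ := by positivity
  have hDκ : D * κ ≤ e := by
    have : (D + 1) * κ = e := mul_div_cancel₀ _ (by positivity)
    linarith
  have hd : Tendsto (fun h => |⟪d, h⟫_ℝ|) (𝓝 (0 : Euc N)) (𝓝 0) := by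
    have : Continuous fun h : Euc N => |⟪d, h⟫_ℝ| := by fun_prop
    exact this.tendsto' 0 0 (by simp)
  have key := difference_test hΩ hF1 hF3 hU hV hg₁ hg₂ hsub hsup hx
    (a := (-(2 * B * f x)) • d) (d := d) (b := 2 * B) (c := 4 * B * (|f x| + κ) * C)
    (by positivity) (by positivity) (by
      filter_upwards [hf, (tendsto_const_add_nhds_zero x).eventually hmax,
        hd.eventually (gt_mem_nhds hκ0)] with h h1 h2 h3
      obtain ⟨r, hr⟩ : ∃ r, r = f (x + h) - f x - ⟪d, h⟫_ℝ := ⟨_, rfl⟩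
      rw [← hr] at h1
      have h4 : f (x + h) = f x + ⟪d, h⟫_ℝ + r := by rw [hr]; ring
      have h5 : -(r * f x) ≤ C * ‖h‖ ^ 2 * |f x| := by
        refine (neg_le_abs _).trans ?_
        rw [abs_mul]
        gcongr
      have h6 : -(r * ⟪d, h⟫_ℝ) ≤ C * ‖h‖ ^ 2 * κ := by
        refine (neg_le_abs _).trans ?_
        rw [abs_mul]
        gcongr
      have h7 : f x ^ 2 + 2 * f x * ⟪d, h⟫_ℝ + ⟪d, h⟫_ℝ ^ 2 - 2 * (C * ‖h‖ ^ 2 * |f x|)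
          - 2 * (C * ‖h‖ ^ 2 * κ) ≤ f (x + h) ^ 2 := by
        rw [h4]
        nlinarith [sq_nonneg r]
      have h8 := mul_le_mul_of_nonneg_left h7 hB
      rw [real_inner_smul_left]
      linarith)
  linarith

/-- A version of Hopf's lemma: a nonpositive difference cannot vanish at a boundary point of a ball
on which it is negative. -/
lemma not_touching_ball {Ω : Set (Euc N)} (hΩ : IsOpen Ω)
    {F : Euc N → Matrix (Fin N) (Fin N) ℝ → ℝ} {lam Lam : ℝ} (hF1 : IsF1 Ω F lam Lam)
    (hF3 : IsF3 Ω F)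
    {U V g₁ g₂ : Euc N → ℝ} (hU : ContinuousOn U Ω) (hV : ContinuousOn V Ω)
    (hg₁ : ContinuousOn g₁ Ω) (hg₂ : ContinuousOn g₂ Ω)
    (hsub : QuadSubsol Ω F g₂ U) (hsup : QuadSupersol Ω F g₁ V) (hle : ∀ x ∈ Ω, U x ≤ V x)
    {z : Euc N} (hz : z ∈ Ω) {C₀ : ℝ} (hC₀ : 0 ≤ C₀)
    (hg : ∀ᶠ x in 𝓝 z, g₂ x - g₁ x ≤ C₀ * (V x - U x)) (hUV : U z = V z) {e : Euc N} (he : e ≠ 0)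
    (hlt : ∀ x ∈ Ω, ‖x - (z + e)‖ ≤ ‖e‖ → x ≠ z → U x < V x) : False := by
  have hLam : 0 < Lam := hF1.1.trans_le hF1.2.1
  have hR : 0 < ‖e‖ := norm_pos_iff.2 he
  have hlamR : 0 < 2 * lam * ‖e‖ ^ 2 := by have := hF1.1; positivity
  obtain ⟨s, hs, hs_lt⟩ : ∃ s > 0, 8 * Lam * N * s + 4 * C₀ * s ^ 2 < 2 * lam * ‖e‖ ^ 2 := by
    have hc : Tendsto (fun s : ℝ => 8 * Lam * N * s + 4 * C₀ * s ^ 2) (𝓝[>] 0) (𝓝 0) := by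
      have : Continuous fun s : ℝ => 8 * Lam * N * s + 4 * C₀ * s ^ 2 := by fun_prop
      exact (this.tendsto' 0 0 (by simp)).mono_left nhdsWithin_le_nhds
    obtain ⟨s, h1, h2⟩ := ((hc.eventually (gt_mem_nhds hlamR)).and self_mem_nhdsWithin).exists
    exact ⟨s, h2, h1⟩
  set q : Euc N → ℝ := fun x => ‖e‖ ^ 2 - ‖x - (z + e)‖ ^ 2 with hq
  have hqc : Continuous q := by fun_prop
  have hqz : q z = 0 := by simp [hq]
  have hqs : ∀ᶠ x in 𝓝 z, |q x| < s :=
    (hqc.abs.tendsto' z 0 (by simp [hqz])).eventually (gt_mem_nhds hs)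
  obtain ⟨r₀, hr₀, hball⟩ := Metric.eventually_nhds_iff_ball.1
    ((hg.and hqs).and (hΩ.mem_nhds hz))
  set r := min (r₀ / 2) (‖e‖ / 2) with hr
  have hr0 : 0 < r := lt_min (by positivity) (by positivity)
  have hrR : r ≤ ‖e‖ / 2 := min_le_right _ _
  have hball' : ∀ x ∈ closedBall z r, (g₂ x - g₁ x ≤ C₀ * (V x - U x) ∧ |q x| < s) ∧ x ∈ Ω :=
    fun x hx => hball x (closedBall_subset_ball ((min_le_left _ _).trans_lt (half_lt_self hr₀)) hx)
  have hsubΩ : closedBall z r ⊆ Ω := fun x hx => (hball' x hx).2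
  obtain ⟨m, hm, hmV⟩ : ∃ m > 0, ∀ x ∈ sphere z r ∩ closedBall (z + e) ‖e‖, m ≤ V x - U x := by
    refine IsCompact.exists_forall_le' ((isCompact_sphere z r).inter_right isClosed_closedBall)
      (f := fun x => V x - U x)
      ((hV.sub hU).mono (inter_subset_left.trans (sphere_subset_closedBall.trans hsubΩ)))
      fun x hx => sub_pos.2 (hlt x (hsubΩ (sphere_subset_closedBall hx.1)) ?_ ?_)
    · simpa [dist_eq_norm] using hx.2
    · rintro rfl
      have := mem_sphere.1 hx.1
      rw [dist_self] at this
      exact hr0.ne this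
  set η := m / (8 * s ^ 2) with hη
  have hη0 : 0 < η := by positivity
  have hηs : η * (4 * s ^ 2) = m / 2 := by rw [hη]; field_simp; norm_num
  set f : Euc N → ℝ := fun x => q x + s with hf
  have hfc : Continuous f := by fun_prop
  have hf_abs : ∀ x ∈ closedBall z r, |f x| ≤ 2 * s := by
    intro x hx
    have := (abs_lt.1 (hball' x hx).1.2)
    rw [abs_le]
    constructor <;> simp only [hf] <;> linarith
  have hf_sq : ∀ x ∈ closedBall z r, f x ^ 2 ≤ 4 * s ^ 2 := by
    intro x hx
    rw [← sq_abs]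
    nlinarith [hf_abs x hx, abs_nonneg (f x)]
  obtain ⟨x, hx, hxmax⟩ := (isCompact_closedBall z r).exists_isMaxOn
    ⟨z, mem_closedBall_self hr0.le⟩ (f := fun x => U x - V x + η * f x ^ 2)
    (((hU.sub hV).mono hsubΩ).add (by fun_prop))
  have hxz : η * s ^ 2 ≤ U x - V x + η * f x ^ 2 := by
    have := isMaxOn_iff.1 hxmax z (mem_closedBall_self hr0.le)
    simpa [hUV, hf, hqz] using this
  have hxlt : dist x z < r := by
    refine lt_of_le_of_ne hx fun hxr => ?_
    by_cases hxe : x ∈ closedBall (z + e) ‖e‖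
    · have h1 := hmV x ⟨hxr, hxe⟩
      have h2 := mul_le_mul_of_nonneg_left (hf_sq x hx) hη0.le
      have : 0 < η * s ^ 2 := by positivity
      linarith
    · have h1 : q x < 0 := by
        rw [mem_closedBall, dist_eq_norm, not_le] at hxe
        have : ‖e‖ ^ 2 < ‖x - (z + e)‖ ^ 2 := by gcongr
        simp only [hq]
        linarith
      have h2 := (abs_lt.1 (hball' x hx).1.2).1
      have h3 : f x ^ 2 < s ^ 2 := by
        simp only [hf]
        nlinarith
      have h4 := hle x (hsubΩ hx)
      have h5 := mul_lt_mul_of_pos_left h3 hη0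
      linarith
  have key := barrier_test hΩ hF1 hF3 hU hV hg₁ hg₂ hsub hsup (hsubΩ hx) (f := f)
    (d := (-2 : ℝ) • (x - (z + e))) hη0.le zero_le_one (.of_forall fun h => by
      have : f (x + h) - f x - ⟪(-2 : ℝ) • (x - (z + e)), h⟫_ℝ = -‖h‖ ^ 2 := by
        simp only [hf, hq, add_sub_right_comm x h, norm_add_sq_real, real_inner_smul_left]
        ring
      rw [this, abs_neg, abs_of_nonneg (by positivity), one_mul])
    (by
      filter_upwards [closedBall_mem_nhds_of_mem hxlt] with y hy
      exact isMaxOn_iff.1 hxmax y hy)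
  have h1 : ‖e‖ / 2 ≤ ‖x - (z + e)‖ := by
    have h2 : ‖e‖ ≤ ‖x - (z + e)‖ + ‖x - z‖ := by
      have : e = -(x - (z + e)) + (x - z) := by abel
      conv_lhs => rw [this]
      refine (norm_add_le _ _).trans ?_
      rw [norm_neg]
    rw [dist_eq_norm] at hxlt
    linarith
  have h2 : ‖e‖ ^ 2 ≤ ‖(-2 : ℝ) • (x - (z + e))‖ ^ 2 := by
    rw [norm_smul]
    norm_num
    gcongr
    linarith
  have h3 := (hball' x hx).1.1
  have h4 : V x - U x ≤ η * (4 * s ^ 2) := by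
    have := mul_le_mul_of_nonneg_left (hf_sq x hx) hη0.le
    have : 0 < η * s ^ 2 := by positivity
    linarith
  have h5 := mul_le_mul_of_nonneg_left h4 hC₀
  have h6 : 4 * Lam * N * η * 1 * |f x| ≤ 4 * Lam * N * η * 1 * (2 * s) := by
    have := hf_abs x hx
    gcongr
  have h7 : 2 * lam * η * ‖e‖ ^ 2 ≤ 2 * lam * η * ‖(-2 : ℝ) • (x - (z + e))‖ ^ 2 := by
    have := hF1.1
    gcongr
  have h8 := mul_lt_mul_of_pos_left hs_lt hη0
  linarith

/-- The strong maximum principle for the difference of a subsolution and a supersolution. -/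
lemma strong_maximum_principle {Ω : Set (Euc N)} (hΩ : IsOpen Ω) (hconn : IsPreconnected Ω)
    {F : Euc N → Matrix (Fin N) (Fin N) ℝ → ℝ} {lam Lam : ℝ} (hF1 : IsF1 Ω F lam Lam)
    (hF3 : IsF3 Ω F)
    {U V g₁ g₂ : Euc N → ℝ} (hU : ContinuousOn U Ω) (hV : ContinuousOn V Ω)
    (hg₁ : ContinuousOn g₁ Ω) (hg₂ : ContinuousOn g₂ Ω)
    (hsub : QuadSubsol Ω F g₂ U) (hsup : QuadSupersol Ω F g₁ V) (hle : ∀ x ∈ Ω, U x ≤ V x)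
    (hg : ∀ z ∈ Ω, ∃ C₀, 0 ≤ C₀ ∧ ∀ᶠ x in 𝓝 z, g₂ x - g₁ x ≤ C₀ * (V x - U x))
    {x₀ : Euc N} (hx₀ : x₀ ∈ Ω) (hUV : U x₀ = V x₀) : ∀ x ∈ Ω, U x = V x := by
  have hopen : IsOpen {x | x ∈ Ω ∧ U x = V x} := by
    refine isOpen_iff_mem_nhds.2 fun z₀ ⟨hz₀, hz₀UV⟩ => ?_
    obtain ⟨ρ, hρ, hball⟩ := Metric.isOpen_iff.1 hΩ z₀ hz₀
    refine mem_of_superset (ball_mem_nhds z₀ (show 0 < ρ / 3 by positivity)) fun w hw => ?_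
    have hwΩ : w ∈ Ω := hball (ball_subset_ball (by linarith) hw)
    refine ⟨hwΩ, ?_⟩
    by_contra hne
    have hK : closedBall z₀ (2 * ρ / 3) ⊆ Ω :=
      (closedBall_subset_ball (by linarith)).trans hball
    set Z := {x ∈ closedBall z₀ (2 * ρ / 3) | U x = V x} with hZ
    have hZc : IsCompact Z := by
      have hcl : IsClosed Z := by
        have := ((hU.sub hV).mono hK).preimage_isClosed_of_isClosed isClosed_closedBall
          (isClosed_singleton (x := (0 : ℝ)))
        convert this using 1
        ext x
        simp [hZ, sub_eq_zero]
      exact (isCompact_closedBall z₀ (2 * ρ / 3)).of_isClosed_subset hcl fun x hx => hx.1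
    have hz₀Z : z₀ ∈ Z := ⟨mem_closedBall_self (by positivity), hz₀UV⟩
    obtain ⟨z, hz, hzmin⟩ := hZc.exists_isMinOn ⟨z₀, hz₀Z⟩
      (f := fun x => ‖x - w‖) (by fun_prop)
    have hzmin' := isMinOn_iff.1 hzmin
    have hzw : ‖z - w‖ < ρ / 3 := (hzmin' z₀ hz₀Z).trans_lt (by
      rwa [← dist_eq_norm, dist_comm])
    obtain ⟨C₀, hC₀, hgz⟩ := hg z (hK hz.1)
    obtain ⟨e, hwe⟩ : ∃ e : Euc N, w = z + (2 : ℝ) • e :=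
      ⟨(1 / 2 : ℝ) • (w - z), by rw [smul_smul]; norm_num⟩
    have he0 : e ≠ 0 := by
      intro h0
      rw [h0, smul_zero, add_zero] at hwe
      exact hne (hwe ▸ hz.2)
    refine not_touching_ball hΩ hF1 hF3 hU hV hg₁ hg₂ hsub hsup hle (hK hz.1) hC₀ hgz hz.2 he0
      fun x hx hxe hxz => lt_of_le_of_ne (hle x hx) fun hxUV => hxz ?_
    have h1 : ‖x - z‖ ^ 2 ≤ 2 * ⟪x - z, e⟫_ℝ := by
      have : ‖x - (z + e)‖ ^ 2 ≤ ‖e‖ ^ 2 := by gcongr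
      rw [← sub_sub, norm_sub_sq_real] at this
      linarith
    have h4 : ‖z - w‖ = 2 * ‖e‖ := by
      rw [hwe, sub_add_cancel_left, norm_neg, norm_smul]
      norm_num
    have hxw : ‖x - w‖ ≤ ‖z - w‖ := by
      have : x - w = (x - (z + e)) - e := by rw [hwe, two_smul]; abel
      rw [this]
      refine (norm_sub_le _ _).trans ?_
      linarith
    have hxZ : x ∈ Z := by
      refine ⟨?_, hxUV⟩
      have h5 := dist_triangle x w z₀
      rw [dist_eq_norm x w] at h5
      have := mem_ball.1 hw
      rw [mem_closedBall]
      linarith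
    have h2 : 4 * ⟪x - z, e⟫_ℝ ≤ ‖x - z‖ ^ 2 := by
      have h3 : ‖z - w‖ ^ 2 ≤ ‖x - w‖ ^ 2 := by
        gcongr
        exact hzmin' x hxZ
      rw [h4, hwe, ← sub_sub, norm_sub_sq_real, inner_smul_right, norm_smul, Real.norm_eq_abs,
        abs_two] at h3
      linarith
    have h3 : ‖x - z‖ ^ 2 ≤ 0 := by linarith
    exact sub_eq_zero.1 (norm_eq_zero.1 (pow_eq_zero_iff two_ne_zero |>.1
      (le_antisymm h3 (sq_nonneg _))))
  have hopen' : IsOpen {x | x ∈ Ω ∧ U x ≠ V x} := by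
    have := (hU.sub hV).isOpen_inter_preimage hΩ (isOpen_compl_singleton (x := (0 : ℝ)))
    convert this using 1
    ext x
    simp [sub_eq_zero]
  intro x hx
  by_contra hne
  obtain ⟨y, -, hy1, hy2⟩ := hconn _ _ hopen hopen' (fun y hy => by
    by_cases h : U y = V y
    · exact Or.inl ⟨hy, h⟩
    · exact Or.inr ⟨hy, h⟩) ⟨x₀, hx₀, hx₀, hUV⟩ ⟨x, hx, hx, hne⟩
  exact hy2.2 hy1.2

end MaximumPrinciple

section BoundaryLayer

variable {N : ℕ}

/-- Taylor's formula with a remainder that is uniform on bounded sets. -/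
lemma exists_uniform_taylor {f : Euc N → ℝ} (hf : ContDiff ℝ 2 f) {K : Set (Euc N)}
    (hK : IsBounded K) :
    ∃ C, 0 ≤ C ∧ ∀ x ∈ K, ∀ᶠ h in 𝓝 (0 : Euc N),
      |f (x + h) - f x - ⟪gradient f x, h⟫_ℝ| ≤ C * ‖h‖ ^ 2 := by
  obtain ⟨R, hR⟩ := hK.subset_closedBall (0 : Euc N)
  have hf' : ContDiff ℝ 1 (fderiv ℝ f) := hf.fderiv_right (m := 1) (by norm_num)
  have hd : Differentiable ℝ f := hf.differentiable (by norm_num)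
  obtain ⟨C, hC⟩ := (isCompact_closedBall (0 : Euc N) (R + 1)).exists_bound_of_continuousOn
    (f := fderiv ℝ (fderiv ℝ f)) (hf'.continuous_fderiv (by norm_num)).continuousOn
  refine ⟨max C 0, le_max_right _ _, fun x hx => ?_⟩
  have hxR : ‖x‖ ≤ R := by simpa using hR hx
  filter_upwards [closedBall_mem_nhds (0 : Euc N) one_pos] with h hh
  have hh1 : ‖h‖ ≤ 1 := by simpa using hh
  have hsub : closedBall x ‖h‖ ⊆ closedBall 0 (R + 1) :=
    closedBall_subset_closedBall' (by rw [dist_zero_right]; linarith)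
  have hx0 : x ∈ closedBall x ‖h‖ := mem_closedBall_self (norm_nonneg h)
  have hbound : ∀ y ∈ closedBall x ‖h‖, ‖fderiv ℝ f y - fderiv ℝ f x‖ ≤ max C 0 * ‖h‖ := by
    intro y hy
    refine ((convex_closedBall (0 : Euc N) (R + 1)).norm_image_sub_le_of_norm_fderiv_le
      (f := fderiv ℝ f) (C := max C 0) (fun z _ => hf'.differentiable (by norm_num) z)
      (fun z hz => (hC z hz).trans (le_max_left _ _)) (hsub hx0) (hsub hy)).trans ?_
    rw [mem_closedBall, dist_eq_norm] at hy
    gcongr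
  have key := (convex_closedBall x ‖h‖).norm_image_sub_le_of_norm_hasFDerivWithin_le'
    (f := f) (f' := fderiv ℝ f) (φ := fderiv ℝ f x) (C := max C 0 * ‖h‖) (y := x + h)
    (fun y _ => (hd y).hasFDerivAt.hasFDerivWithinAt) hbound hx0 (by simp)
  rw [add_sub_cancel_left, Real.norm_eq_abs] at key
  rw [gradient, InnerProductSpace.toDual_symm_apply]
  exact key.trans_eq (by ring)

/-- Comparison in a thin layer along the boundary. -/
lemma boundary_layer_comparison {Ω : Set (Euc N)} (hΩ : IsOpen Ω) (hbdd : IsBounded Ω)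
    {F : Euc N → Matrix (Fin N) (Fin N) ℝ → ℝ} {lam Lam : ℝ} (hF1 : IsF1 Ω F lam Lam)
    (hF3 : IsF3 Ω F) {f : Euc N → ℝ} (hf : ContDiff ℝ 2 f) (hfΩ : Ω = {x | f x < 0})
    (hfr : frontier Ω = {x | f x = 0}) (hgrad : ∀ x ∈ frontier Ω, fderiv ℝ f x ≠ 0)
    {C₀ : ℝ} (hC₀ : 0 ≤ C₀) :
    ∃ δ > 0, ∀ U V g₁ g₂ : Euc N → ℝ, ContinuousOn U (closure Ω) → ContinuousOn V (closure Ω) →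
      ContinuousOn g₁ Ω → ContinuousOn g₂ Ω → QuadSubsol Ω F g₂ U → QuadSupersol Ω F g₁ V →
      (∀ x ∈ Ω, V x < U x → g₂ x - g₁ x ≤ C₀ * (U x - V x)) →
      (∀ x ∈ frontier Ω, U x ≤ V x) → (∀ x ∈ Ω, f x ≤ -δ → U x ≤ V x) →
      ∀ x ∈ Ω, U x ≤ V x := by
  have hLam : 0 < Lam := hF1.1.trans_le hF1.2.1
  have hcomp : IsCompact (closure Ω) := hbdd.isCompact_closure
  have hmem : ∀ x ∈ closure Ω, f x < 0 ∨ f x = 0 ∧ fderiv ℝ f x ≠ 0 := by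
    intro x hx
    rw [closure_eq_self_union_frontier] at hx
    rcases hx with hx | hx
    · rw [hfΩ] at hx
      exact Or.inl hx
    · refine Or.inr ⟨?_, hgrad x hx⟩
      rw [hfr] at hx
      exact hx
  have hnorm : ∀ x, ‖gradient f x‖ = ‖fderiv ℝ f x‖ := fun x => by
    rw [gradient, LinearIsometryEquiv.norm_map]
  obtain ⟨C, hC, hTaylor⟩ := exists_uniform_taylor hf hbdd.closure
  obtain ⟨c, hc, hcf⟩ : ∃ c > 0, ∀ x ∈ closure Ω, c ≤ ‖fderiv ℝ f x‖ ^ 2 - f x := by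
    have hf' := hf.continuous_fderiv (by norm_num)
    refine hcomp.exists_forall_le' (f := fun x => ‖fderiv ℝ f x‖ ^ 2 - f x)
      ((hf'.norm.pow 2).sub hf.continuous).continuousOn fun x hx => ?_
    rcases hmem x hx with h | ⟨h, h'⟩
    · have := sq_nonneg ‖fderiv ℝ f x‖
      linarith
    · rw [h, sub_zero]
      have := norm_pos_iff.2 h'
      positivity
  have hlc : 0 < lam * c := mul_pos hF1.1 hc
  obtain ⟨δ, hδ, hδc, hδ_lt⟩ : ∃ δ > 0, δ < c / 2 ∧
      4 * Lam * N * C * δ + 2 * C₀ * δ ^ 2 < lam * c := by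
    have h0 : Tendsto (fun s : ℝ => 4 * Lam * N * C * s + 2 * C₀ * s ^ 2) (𝓝[>] 0) (𝓝 0) := by
      have : Continuous fun s : ℝ => 4 * Lam * N * C * s + 2 * C₀ * s ^ 2 := by fun_prop
      exact (this.tendsto' 0 0 (by simp)).mono_left nhdsWithin_le_nhds
    obtain ⟨s, h1, h2, h3⟩ := ((h0.eventually (gt_mem_nhds hlc)).and
      (((eventually_lt_nhds (half_pos hc)).filter_mono nhdsWithin_le_nhds).and
        self_mem_nhdsWithin)).exists
    exact ⟨s, h3, h2, h1⟩
  refine ⟨δ, hδ, fun U V g₁ g₂ hU hV hg₁ hg₂ hsub hsup hg hfrUV hinner => ?_⟩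
  by_contra! ⟨x₀, hx₀, hx₀UV⟩
  set ψ : Euc N → ℝ := fun x => 2 - (f x + δ) ^ 2 / δ ^ 2 with hψ
  have hψc : Continuous ψ := by have := hf.continuous; fun_prop
  set L := closure Ω ∩ {x | -δ ≤ f x} with hL
  have hLc : IsCompact L := hcomp.inter_right (isClosed_le continuous_const hf.continuous)
  have hf0 : ∀ x ∈ L, f x ≤ 0 := fun x hx => (hmem x hx.1).elim le_of_lt fun h => h.1.le
  have hψ1 : ∀ x ∈ L, 1 ≤ ψ x := by
    intro x hx
    have h1 : (f x + δ) ^ 2 / δ ^ 2 ≤ 1 := by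
      rw [div_le_one (by positivity)]
      have h2 : 0 ≤ f x + δ := by linarith [show -δ ≤ f x from hx.2]
      have h3 : f x + δ ≤ δ := by linarith [hf0 x hx]
      gcongr
    simp only [hψ]
    linarith
  have hx₀L : x₀ ∈ L := by
    refine ⟨subset_closure hx₀, show -δ ≤ f x₀ from ?_⟩
    by_contra! h
    exact (hinner x₀ hx₀ h.le).not_gt hx₀UV
  obtain ⟨x, hx, hxmax⟩ := hLc.exists_isMaxOn ⟨x₀, hx₀L⟩ (f := fun x => (U x - V x) / ψ x)
    (((hU.sub hV).mono inter_subset_left).div hψc.continuousOn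
      fun x hx => (zero_lt_one.trans_le (hψ1 x hx)).ne')
  have hψx : 0 < ψ x := zero_lt_one.trans_le (hψ1 x hx)
  obtain ⟨t, ht⟩ : ∃ t, t = (U x - V x) / ψ x := ⟨_, rfl⟩
  have htmax : ∀ y ∈ L, U y - V y ≤ t * ψ y := fun y hy => by
    rw [ht, ← div_le_iff₀ (zero_lt_one.trans_le (hψ1 y hy))]
    exact isMaxOn_iff.1 hxmax y hy
  have ht0 : 0 < t := by
    have h1 := htmax x₀ hx₀L
    have h2 := hψ1 x₀ hx₀L
    exact pos_of_mul_pos_left (by linarith) (zero_le_one.trans h2)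
  have htx : U x - V x = t * ψ x := by rw [ht, div_mul_cancel₀ _ hψx.ne']
  have hxUV : V x < U x := by
    have := mul_pos ht0 hψx
    linarith
  have hxΩ : x ∈ Ω := by
    by_contra h
    have : x ∈ frontier Ω := by rw [hΩ.frontier_eq]; exact ⟨hx.1, h⟩
    exact (hfrUV x this).not_gt hxUV
  have hfx : -δ < f x := by
    by_contra! h
    exact (hinner x hxΩ h).not_gt hxUV
  set B := t / δ ^ 2 with hB
  have hB0 : 0 < B := by positivity
  have hBt : B * δ ^ 2 = t := div_mul_cancel₀ _ (by positivity)
  have htψ : ∀ y, t * ψ y = 2 * t - B * (f y + δ) ^ 2 := fun y => by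
    simp only [hψ, hB]
    field_simp
  have key := barrier_test hΩ hF1 hF3 (hU.mono subset_closure) (hV.mono subset_closure) hg₁ hg₂
    hsub hsup hxΩ (f := fun y => f y + δ) (d := gradient f x) hB0.le hC
    (by simpa using hTaylor x hx.1) (by
      filter_upwards [hΩ.mem_nhds hxΩ,
        (isOpen_lt continuous_const hf.continuous).mem_nhds hfx] with y hy hy'
      have h1 := htmax y ⟨subset_closure hy, le_of_lt hy'⟩
      rw [htψ] at h1 htx
      linarith)
  have h1 : c / 2 ≤ ‖gradient f x‖ ^ 2 := by
    rw [hnorm]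
    linarith [hcf x hx.1]
  have h2 : |f x + δ| ≤ δ := by
    rw [abs_of_pos (by linarith)]
    linarith [hf0 x hx]
  have h3 : 4 * Lam * N * B * C * |f x + δ| ≤ 4 * Lam * N * B * C * δ := by gcongr
  have h4 : 2 * lam * B * (c / 2) ≤ 2 * lam * B * ‖gradient f x‖ ^ 2 := by
    have := hF1.1
    gcongr
  have h5 : C₀ * (U x - V x) ≤ C₀ * (2 * (B * δ ^ 2)) := by
    rw [htx, htψ, hBt]
    have : 0 ≤ B * (f x + δ) ^ 2 := by positivity
    gcongr
    linarith
  have h6 := hg x hxΩ hxUV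
  have h7 := mul_lt_mul_of_pos_left hδ_lt hB0
  linarith

end BoundaryLayer

/-- Convexity of the power function. -/
lemma rpow_sub_rpow_le {a b p : ℝ} (ha : 0 ≤ a) (hb : 0 < b) (hp : 1 ≤ p) :
    b ^ p - a ^ p ≤ p * b ^ (p - 1) * (b - a) := by
  have h := one_add_mul_self_le_rpow_one_add (s := a / b - 1)
    (by linarith [div_nonneg ha hb.le]) hp
  rw [add_sub_cancel, Real.div_rpow ha hb.le, le_div_iff₀ (Real.rpow_pos_of_pos hb p)] at h
  have hbp : b ^ p = b ^ (p - 1) * b := by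
    rw [← Real.rpow_add_one hb.ne', sub_add_cancel]
  have h' : (1 + p * (a / b - 1)) * b ^ p = b ^ p - p * b ^ (p - 1) * (b - a) := by
    rw [hbp]
    field_simp
    ring
  linarith

/-- comparison principle for the logistic equation: if `u₁ > 0` is a viscosity
supersolution and `u₂ ≥ 0` a viscosity subsolution of `F(x,D²u)+μu = k(x)u^p` in `Ω`, with
`k ≥ 0` not identically zero, and `u₁ ≥ u₂` on `∂Ω`, then `u₁ ≥ u₂` in `Ω`. -/
theorem statement9 {N : ℕ} (Ω : Set (Euc N))
    (F : Euc N → Matrix (Fin N) (Fin N) ℝ → ℝ) (lam Lam p μ : ℝ)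
    (k : Euc N → ℝ) (u₁ u₂ : Euc N → ℝ)
    (hΩ : IsC2Domain Ω) (hFc : FCont Ω F)
    (hF1 : IsF1 Ω F lam Lam) (hF2 : IsF2 Ω F) (hF3 : IsF3 Ω F)
    (hp : 1 < p) (hk_cont : ContinuousOn k Ω)
    (hk_nonneg : ∀ x ∈ Ω, 0 ≤ k x) (hk_ne : ∃ x ∈ Ω, k x ≠ 0)
    (hu₁_cont : ContinuousOn u₁ (closure Ω)) (hu₂_cont : ContinuousOn u₂ (closure Ω))
    (hu₁_pos : ∀ x ∈ Ω, 0 < u₁ x) (hu₂_nonneg : ∀ x ∈ Ω, 0 ≤ u₂ x)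
    (hsuper : ViscSupersol Ω (logisticG F μ k p) u₁)
    (hsub : ViscSubsol Ω (logisticG F μ k p) u₂)
    (hbd : ∀ x ∈ frontier Ω, u₂ x ≤ u₁ x) :
    ∀ x ∈ Ω, u₂ x ≤ u₁ x := by
  obtain ⟨hΩo, hΩb, -, hΩconn, f, hf, hfΩ, hfr, hgrad⟩ := hΩ
  have hp0 : 0 ≤ p := by linarith
  have hcomp : IsCompact (closure Ω) := hΩb.isCompact_closure
  have hu₁ := hu₁_cont.mono (subset_closure (s := Ω))
  have hu₂ := hu₂_cont.mono (subset_closure (s := Ω))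
  have hg : ∀ u : Euc N → ℝ, ContinuousOn u Ω →
      ContinuousOn (fun x => μ * u x - k x * u x ^ p) Ω := fun u hu =>
    (continuousOn_const.mul hu).sub (hk_cont.mul (hu.rpow_const fun _ _ => Or.inr hp0))
  have hu₁_nonneg : ∀ x ∈ closure Ω, 0 ≤ u₁ x := fun x hx => by
    have h : closure (u₁ '' Ω) ⊆ Ici 0 :=
      closure_minimal (by rintro _ ⟨y, hy, rfl⟩; exact (hu₁_pos y hy).le) isClosed_Ici
    exact h (hu₁_cont.image_closure ⟨x, hx, rfl⟩)
  have hscale : ∀ {τ}, 1 ≤ τ → ∀ x ∈ Ω, τ * u₁ x ^ p ≤ (τ * u₁ x) ^ p := fun {τ} hτ x hx => by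
    rw [Real.mul_rpow (by linarith) (hu₁_pos x hx).le]
    have := hu₁_pos x hx
    gcongr
    exact Real.self_le_rpow_of_one_le hτ hp.le
  have hgτ : ∀ τ : ℝ, ContinuousOn (fun x => τ * (μ * u₁ x - k x * u₁ x ^ p)) Ω := fun τ =>
    continuousOn_const.mul (hg u₁ hu₁)
  have hsub' := hsub.quadSubsol
  have hsup' := hsuper.quadSupersol
  obtain ⟨δ, hδ, hlayer⟩ := boundary_layer_comparison hΩo hΩb hF1 hF3 hf hfΩ hfr hgrad
    (abs_nonneg μ)
  set K := closure Ω ∩ {x | f x ≤ -δ} with hK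
  have hKc : IsCompact K := hcomp.inter_right (isClosed_le hf.continuous continuous_const)
  have hKΩ : K ⊆ Ω := fun x hx => by
    rw [hfΩ]
    exact (show f x ≤ -δ from hx.2).trans_lt (neg_lt_zero.2 hδ)
  have hle : ∀ τ, 1 ≤ τ → (∀ x ∈ K, u₂ x ≤ τ * u₁ x) → ∀ x ∈ Ω, u₂ x ≤ τ * u₁ x := by
    intro τ hτ hτK
    have hτ0 : 0 < τ := zero_lt_one.trans_le hτ
    refine hlayer u₂ (fun x => τ * u₁ x) _ _ hu₂_cont (continuousOn_const.mul hu₁_cont)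
      (hgτ τ) (hg u₂ hu₂) hsub' (hsup'.const_mul hF2 hτ0)
      (fun x hx hlt => ?_) (fun x hx => ?_) fun x hx hfx => hτK x ⟨subset_closure hx, hfx⟩
    · have h1 : (τ * u₁ x) ^ p ≤ u₂ x ^ p :=
        Real.rpow_le_rpow (mul_pos hτ0 (hu₁_pos x hx)).le hlt.le hp0
      have h2 := mul_le_mul_of_nonneg_left ((hscale hτ x hx).trans h1) (hk_nonneg x hx)
      have h3 := mul_le_mul_of_nonneg_right (le_abs_self μ) (sub_nonneg.2 hlt.le)
      linarith
    · exact (hbd x hx).trans (le_mul_of_one_le_left (hu₁_nonneg x (frontier_subset_closure hx)) hτ)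
  by_contra! hcon
  have hKne : ∃ x ∈ K, u₁ x < u₂ x := by
    by_contra! h
    obtain ⟨x, hx, hlt⟩ := hcon
    have := hle 1 le_rfl (by simpa using h) x hx
    linarith
  obtain ⟨y, hy, hylt⟩ := hKne
  obtain ⟨x₀, hx₀, hx₀max⟩ := hKc.exists_isMaxOn ⟨y, hy⟩ (f := fun x => u₂ x / u₁ x)
    ((hu₂.mono hKΩ).div (hu₁.mono hKΩ) fun x hx => (hu₁_pos x (hKΩ hx)).ne')
  obtain ⟨τ, hτ⟩ : ∃ τ, τ = u₂ x₀ / u₁ x₀ := ⟨_, rfl⟩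
  have hτmax : ∀ x ∈ K, u₂ x ≤ τ * u₁ x := fun x hx => by
    rw [hτ, ← div_le_iff₀ (hu₁_pos x (hKΩ hx))]
    exact isMaxOn_iff.1 hx₀max x hx
  have hτ1 : 1 < τ := by
    have h1 := hylt.trans_le (hτmax y hy)
    exact (lt_mul_iff_one_lt_left (hu₁_pos y (hKΩ hy))).1 h1
  have hτ0 : 0 < τ := zero_lt_one.trans hτ1
  have hV : ContinuousOn (fun x => τ * u₁ x) Ω := continuousOn_const.mul hu₁
  have hVpos : ∀ x ∈ Ω, 0 < τ * u₁ x := fun x hx => mul_pos hτ0 (hu₁_pos x hx)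
  have hsupV := hsup'.const_mul hF2 hτ0
  have hleΩ := hle τ hτ1.le hτmax
  have heq := strong_maximum_principle hΩo hΩconn.isPreconnected hF1 hF3 hu₂ hV (hgτ τ) (hg u₂ hu₂)
    hsub' hsupV hleΩ (fun z hz => by
      have hc : ContinuousOn (fun x => |μ| + k x * (p * (τ * u₁ x) ^ (p - 1))) Ω :=
        continuousOn_const.add (hk_cont.mul (continuousOn_const.mul
          (hV.rpow_const fun x hx => Or.inl (hVpos x hx).ne')))
      refine ⟨|μ| + k z * (p * (τ * u₁ z) ^ (p - 1)) + 1, ?_, ?_⟩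
      · have := hk_nonneg z hz
        have := hVpos z hz
        positivity
      filter_upwards [(hc.continuousAt (hΩo.mem_nhds hz)).eventually
        (eventually_lt_nhds (lt_add_one _)), hΩo.mem_nhds hz] with x hx hxΩ
      have h1 := sub_nonneg.2 (hleΩ x hxΩ)
      have h2 := mul_le_mul_of_nonneg_right hx.le h1
      have h3 := mul_le_mul_of_nonneg_left (hscale hτ1.le x hxΩ) (hk_nonneg x hxΩ)
      have h4 := mul_le_mul_of_nonneg_left
        (rpow_sub_rpow_le (hu₂_nonneg x hxΩ) (hVpos x hxΩ) hp.le) (hk_nonneg x hxΩ)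
      have h5 := mul_le_mul_of_nonneg_right (neg_abs_le μ) h1
      linarith) (hKΩ hx₀) (by rw [hτ, div_mul_cancel₀ _ (hu₁_pos x₀ (hKΩ hx₀)).ne'])
  obtain ⟨x, hx, hkx⟩ := hk_ne
  have key := difference_test hΩo hF1 hF3 hu₂ hV (hgτ τ) (hg u₂ hu₂) hsub' hsupV hx (a := 0) (d := 0)
    le_rfl le_rfl (by
      filter_upwards [(tendsto_const_add_nhds_zero x).eventually (hΩo.mem_nhds hx)] with h hh
      simp [heq x hx, heq _ hh])
  have hlt : τ * u₁ x ^ p < (τ * u₁ x) ^ p := by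
    rw [Real.mul_rpow hτ0.le (hu₁_pos x hx).le]
    have := Real.rpow_pos_of_pos (hu₁_pos x hx) p
    gcongr
    exact Real.self_lt_rpow_of_one_lt hτ1 hp
  have := mul_lt_mul_of_pos_left hlt ((hk_nonneg x hx).lt_of_ne' hkx)
  rw [heq x hx] at key
  simp only [mul_zero, zero_mul, norm_zero] at key
  linarith
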